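/- There exists a constant c > 0 such that for every integer k ≥ 2 and every two-coloring of the edges of the complete graph K_n on n = k − 1 + ⌊k/2⌋ vertices, the number of monochromatic copies of the path P_k is at least (ck)^k. -/

import Mathlib

open Finset

/-- A path copy as a sequence: `k` distinct vertices with consecutive vertices adjacent. -/
def IsPathSeq {V : Type*} (G : SimpleGraph V) (k : ℕ) (f : Fin k → V) : Prop :=
  Function.Injective f ∧ ∀ (i : Fin k) (h : i.val + 1 < k), G.Adj (f i) (f ⟨i.val + 1, h⟩)

/-- Number of copies of the path `P_k` in `G` (sequences identified with their reversals). -/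
noncomputable def pathCount {V : Type*} (G : SimpleGraph V) (k : ℕ) : ℕ :=
  Nat.card {f : Fin k → V // IsPathSeq G k f} / 2

/-- A cycle copy as a cyclic sequence: `k` distinct vertices, cyclically consecutive adjacent. -/
def IsCycleSeq {V : Type*} (G : SimpleGraph V) (k : ℕ) (f : Fin k → V) : Prop :=
  Function.Injective f ∧ ∀ i : Fin k, G.Adj (f i) (f ⟨(i.val + 1) % k, Nat.mod_lt _ i.pos⟩)

/-- Number of copies of the cycle `C_k` in `G` (identified up to rotation and reflection). -/
noncomputable def cycleCount {V : Type*} (G : SimpleGraph V) (k : ℕ) : ℕ :=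
  Nat.card {f : Fin k → V // IsCycleSeq G k f} / (2 * k)

/-- The red graph of the coloring `χ(a,b)`: complete bipartite between the first `a`
vertices and the remaining `b` vertices. The blue graph is its complement. -/
def chiRed (a b : ℕ) : SimpleGraph (Fin (a + b)) :=
  SimpleGraph.fromRel (fun x y => (x.val < a) ≠ (y.val < a))

/-- Number of neighbors of `x` inside the set `Y`. -/
noncomputable def nbrCount {V : Type*} (G : SimpleGraph V) (x : V) (Y : Finset V) : ℕ :=
  Nat.card {y : V // y ∈ Y ∧ G.Adj x y}

/-- `e(X,Y)`: number of pairs in `X × Y` that are edges. -/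
noncomputable def eCnt {V : Type*} (G : SimpleGraph V) (X Y : Finset V) : ℕ :=
  Nat.card {p : V × V // p.1 ∈ X ∧ p.2 ∈ Y ∧ G.Adj p.1 p.2}

/-- Edge density `d(X,Y) = e(X,Y)/(|X||Y|)`. -/
noncomputable def dens {V : Type*} (G : SimpleGraph V) (X Y : Finset V) : ℝ :=
  (eCnt G X Y : ℝ) / ((X.card : ℝ) * (Y.card : ℝ))

/-- `(X,Y)` is an `ε`-regular pair in `G`. -/
def IsRegularPair {V : Type*} (G : SimpleGraph V) (X Y : Finset V) (ε : ℝ) : Prop :=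
  ∀ U, U ⊆ X → ∀ W, W ⊆ Y → ε * X.card ≤ (U.card : ℝ) → ε * Y.card ≤ (W.card : ℝ) →
    |dens G U W - dens G X Y| ≤ ε

/-- `W` is `(t,l)`-well-connected in `G`: any two distinct vertices of `W` are joined by
at least `t` internally vertex-disjoint paths of length at most `l`. -/
def WellConnected {V : Type*} (G : SimpleGraph V) (W : Set V) (t l : ℕ) : Prop :=
  ∀ u ∈ W, ∀ v ∈ W, u ≠ v →
    ∃ P : Fin t → G.Walk u v, Function.Injective P ∧
      (∀ i, (P i).IsPath ∧ (P i).length ≤ l) ∧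
      (∀ i j, i ≠ j → ∀ x, x ∈ (P i).support → x ∈ (P j).support → x = u ∨ x = v)

/-- Extremal coloring with parameter `α` (the red graph is `R`, blue is `Rᶜ`). -/
def IsExtremalColoring {V : Type*} [Fintype V] [DecidableEq V] (R : SimpleGraph V) (α : ℝ) : Prop :=
  ∃ A : Finset V,
    (2/3 - α) * (Fintype.card V : ℝ) ≤ (A.card : ℝ) ∧
    (1/3 - α) * (Fintype.card V : ℝ) ≤ ((Aᶜ).card : ℝ) ∧
    ((1 - α ≤ dens R A A ∧ 1 - α ≤ dens Rᶜ A Aᶜ) ∨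
     (1 - α ≤ dens Rᶜ A A ∧ 1 - α ≤ dens R A Aᶜ))

/-- A path of length `l` in `G[A,B]`: `l+1` distinct vertices alternating between the
parts `A` and `B`, with consecutive vertices adjacent in `G`. -/
def IsAltPath {Ω : Type*} (G : SimpleGraph Ω) (A B : Finset Ω) (l : ℕ) (f : Fin (l + 1) → Ω) : Prop :=
  Function.Injective f ∧
  (∀ i : Fin (l + 1), f i ∈ A ∨ f i ∈ B) ∧
  (∀ (i : Fin (l + 1)) (h : i.val + 1 < l + 1),
    G.Adj (f i) (f ⟨i.val + 1, h⟩) ∧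
    ((f i ∈ A ∧ f ⟨i.val + 1, h⟩ ∈ B) ∨ (f i ∈ B ∧ f ⟨i.val + 1, h⟩ ∈ A)))

/-- A path with `k` vertices alternating between `V` and `U`, starting in `V`. -/
def IsBipPathFromV {Ω : Type*} (G : SimpleGraph Ω) (U V : Finset Ω) (k : ℕ) (f : Fin k → Ω) : Prop :=
  Function.Injective f ∧
  (∀ i : Fin k, (i.val % 2 = 0 → f i ∈ V) ∧ (i.val % 2 = 1 → f i ∈ U)) ∧
  (∀ (i : Fin k) (h : i.val + 1 < k), G.Adj (f i) (f ⟨i.val + 1, h⟩))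

/-- Paths with `k` vertices as lists. -/
def PL {V : Type*} (G : SimpleGraph V) (k : ℕ) : Set (List V) :=
  {l | l.length = k ∧ l.Nodup ∧ l.IsChain G.Adj}

lemma PL_finite {V : Type*} [Finite V] (G : SimpleGraph V) (k : ℕ) : (PL G k).Finite :=
  (List.finite_length_eq V k).subset (fun _ h => h.1)

lemma PL_ncard_le {V : Type*} [Finite V] (G : SimpleGraph V) (k : ℕ) :
    (PL G k).ncard ≤ Nat.card {f : Fin k → V // IsPathSeq G k f} := by
  have : Finite {f : Fin k → V // IsPathSeq G k f} := inferInstance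
  rw [← Nat.card_coe_set_eq]
  refine Nat.card_le_card_of_injective
    (fun l : PL G k => (⟨fun i => l.1.get (i.cast l.2.1.symm), ?_, ?_⟩ :
      {f : Fin k → V // IsPathSeq G k f})) ?_
  · intro i j h
    have := (List.nodup_iff_injective_get.1 l.2.2.1) h
    exact Fin.ext (by simpa using congrArg Fin.val this)
  · intro i h
    have := List.isChain_iff_getElem.1 l.2.2.2 i.val (by rw [l.2.1]; exact h)
    simpa using this
  · intro l l' h
    apply Subtype.ext
    apply List.ext_get (by rw [l.2.1, l'.2.1])
    intro n h1 h2
    have := congrFun (congrArg Subtype.val h) ⟨n, by rw [← l.2.1]; exact h1⟩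
    simpa using this

lemma PL_reverse {V : Type*} {G : SimpleGraph V} {k : ℕ} {l : List V} (h : l ∈ PL G k) :
    l.reverse ∈ PL G k := by
  refine ⟨by simpa using h.1, by simpa using h.2.1, ?_⟩
  rw [List.isChain_reverse]
  exact h.2.2.imp (fun a b hab => hab.symm)

lemma PL_two_le {V : Type*} [Finite V] {G : SimpleGraph V} {k : ℕ} (hk : 2 ≤ k)
    (h : (PL G k).Nonempty) : 2 ≤ (PL G k).ncard := by
  obtain ⟨l, hl⟩ := h
  have : ({l, l.reverse} : Set (List V)) ⊆ PL G k := by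
    rintro x (rfl | rfl)
    · exact hl
    · exact PL_reverse hl
  refine le_trans ?_ (Set.ncard_le_ncard this (PL_finite G k))
  rw [Set.ncard_pair]
  intro e
  obtain ⟨h1, h2, h3⟩ := hl
  have e2 : l[0]'(by omega) = l.reverse[0]'(by simp; omega) := by
    congr 1
  rw [List.getElem_reverse] at e2
  have := (List.Nodup.getElem_inj_iff h2).1 e2
  omega

/-- Greedy counting. -/
lemma tree_cons {α : Type*} [Finite α] (P : List α → Prop) (m : ℕ → ℝ) (hm : ∀ i, 0 ≤ m i)
    (h0 : P []) (k : ℕ)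
    (hs : ∀ l, P l → l.length < k → m l.length ≤ ({x | P (x :: l)} : Set α).ncard) :
    ∏ i ∈ range k, m i ≤ ({l | l.length = k ∧ P l} : Set (List α)).ncard := by
  classical
  have := Fintype.ofFinite α
  induction k with
  | zero =>
    have : ({l | l.length = 0 ∧ P l} : Set (List α)) = {[]} := by
      ext l; simp only [Set.mem_setOf_eq, Set.mem_singleton_iff, List.length_eq_zero_iff]
      constructor
      · exact fun h => h.1
      · rintro rfl; exact ⟨rfl, h0⟩
    rw [this]; simp
  | succ k ih =>
    have ih := ih (fun l h1 h2 => hs l h1 (by omega))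
    have fin : ∀ j, ({l | l.length = j ∧ P l} : Set (List α)).Finite := fun j =>
      (List.finite_length_eq α j).subset (fun _ h => h.1)
    rw [prod_range_succ]
    rw [Set.ncard_eq_toFinset_card _ (fin k)] at ih
    rw [Set.ncard_eq_toFinset_card _ (fin (k+1))]
    set F := (fin k).toFinset with hF
    let S : Finset (Σ _ : List α, α) := F.sigma (fun l => univ.filter (fun x => P (x :: l)))
    have h1 : S.card ≤ (fin (k+1)).toFinset.card := by
      apply Finset.card_le_card_of_injOn (fun p => p.2 :: p.1)
      · rintro ⟨l, x⟩ h
        simp [S, F] at h ⊢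
        exact ⟨h.1.1, h.2⟩
      · rintro ⟨l, x⟩ _ ⟨l', x'⟩ _ h
        simp at h
        obtain ⟨rfl, rfl⟩ := h
        rfl
    calc (∏ x ∈ range k, m x) * m k ≤ F.card * m k := by
          exact mul_le_mul_of_nonneg_right ih (hm k)
      _ = ∑ l ∈ F, m k := by simp
      _ ≤ ∑ l ∈ F, ((univ.filter (fun x => P (x :: l))).card : ℝ) := by
          apply sum_le_sum
          intro l hl
          simp [F] at hl
          have := hs l hl.2 (by omega)
          rw [hl.1] at this
          rw [Set.ncard_eq_toFinset_card'] at this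
          simpa using this
      _ = S.card := by simp [S, Finset.card_sigma]
      _ ≤ _ := by exact_mod_cast h1

/-- good pieces: chains with endpoints in `O` -/
def GP {V : Type*} (G : SimpleGraph V) (O : V → Prop) (P : List V) : Prop :=
  P.IsChain G.Adj ∧ (∃ a p, P = a :: p ∧ O a) ∧ ∃ b p, P = p ++ [b] ∧ O b

lemma GP_join {V : Type*} {G : SimpleGraph V} {O : V → Prop} {a b : V} {p p' : List V} {y : V}
    (h : GP G O (a :: p)) (h' : GP G O (b :: p')) (ha : G.Adj a y) (hb : G.Adj b y) :
    GP G O ((a :: p).reverse ++ y :: b :: p') := by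
  obtain ⟨h1, h2, c, q, h3, h4⟩ := h
  obtain ⟨h1', h2', c', q', h3', h4'⟩ := h'
  refine ⟨?_, ⟨c, q.reverse ++ y :: b :: p', by rw [h3]; simp, h4⟩,
    c', (a :: p).reverse ++ y :: q', by rw [h3']; simp, h4'⟩
  rw [List.isChain_append]
  refine ⟨?_, ?_, ?_⟩
  · rw [List.isChain_reverse]
    exact h1.imp (fun a b hab => hab.symm)
  · rw [List.isChain_cons_cons]; exact ⟨hb.symm, h1'⟩
  · simp [ha]

lemma GP_merge {V : Type*} [DecidableEq V] {G : SimpleGraph V} {O : V → Prop} (Q : List (V × V)) :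
    ∀ (Ls : List (List V)), Ls.length = Q.length + 2 → (∀ P ∈ Ls, GP G O P) →
    (∀ q ∈ Q, ∀ o, O o → G.Adj o q.1 ∨ G.Adj o q.2) →
    ∃ P P', GP G O P ∧ GP G O P' ∧ (P ++ P').length = Ls.flatten.length + Q.length ∧
      (P ++ P').Subperm (Ls.flatten ++ Q.flatMap (fun q => [q.1, q.2])) := by
  induction Q with
  | nil =>
    intro Ls hl hg _
    match Ls, hl with
    | [P, P'], _ =>
      exact ⟨P, P', hg _ (by simp), hg _ (by simp), by simp, by simpa using List.Subperm.refl _⟩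
  | cons q Q ih =>
    intro Ls hl hg hq
    match Ls, hl with
    | A :: B :: C :: Ls, hl =>
      have key : ∀ A B C : List V, GP G O A → GP G O B → GP G O C → 
        (∃ y, (y = q.1 ∨ y = q.2) ∧ ∃ a p b p', A = a :: p ∧ B = b :: p' ∧ G.Adj a y ∧ G.Adj b y) →
        ((A ++ (B ++ C)).length = (A ++ (B ++ C)).length) → 
        ∃ P P', GP G O P ∧ GP G O P' ∧
          (P ++ P').length = A.length + B.length + C.length + Ls.flatten.length + (Q.length + 1) ∧
          ∀ x, (P ++ P').count x ≤ A.count x + B.count x + C.count x + Ls.flatten.count x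
            + (Q.flatMap (fun q => [q.1, q.2])).count x + [q.1, q.2].count x := by
        rintro A B C hA hB hC ⟨y, hy, a, p, b, p', rfl, rfl, h1, h2⟩ _
        obtain ⟨P, P', g1, g2, g3, g4⟩ := ih (((a :: p).reverse ++ y :: b :: p') :: C :: Ls)
          (by simp at hl ⊢; omega) (by
            intro P hP
            simp only [List.mem_cons] at hP
            rcases hP with rfl | rfl | hP
            · exact GP_join hA hB h1 h2
            · exact hC
            · exact hg _ (by simp [hP])) (fun q hq' => hq q (by simp [hq']))
        refine ⟨P, P', g1, g2, ?_, ?_⟩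
        · rw [g3]; simp; omega
        · intro x
          have := List.subperm_iff_count.1 g4 x
          refine this.trans ?_
          have hyy : [y].count x ≤ [q.1, q.2].count x := by
            rcases hy with rfl | rfl <;> simp [List.count_cons]
          simp [List.count_cons, List.count_append] at hyy ⊢
          omega
      have hA := hg A (by simp)
      have hB := hg B (by simp)
      have hC := hg C (by simp)
      have hq0 := hq q (by simp)
      obtain ⟨a, p, rfl, Oa⟩ := hA.2.1
      obtain ⟨b, p', rfl, Ob⟩ := hB.2.1
      obtain ⟨c, p'', rfl, Oc⟩ := hC.2.1
      have fin : ∀ A' B' C' : List V, (∀ x, A'.count x + B'.count x + C'.count x =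
           (a :: p).count x + (b :: p').count x + (c :: p'').count x) →
          (A'.length + B'.length + C'.length =
           (a :: p).length + (b :: p').length + (c :: p'').length) →
          GP G O A' → GP G O B' → GP G O C' → 
          (∃ y, (y = q.1 ∨ y = q.2) ∧ ∃ a p b p', A' = a :: p ∧ B' = b :: p' ∧ G.Adj a y ∧ G.Adj b y) →
          ∃ P P', GP G O P ∧ GP G O P' ∧ (P ++ P').length =
            ((a :: p) :: (b :: p') :: (c :: p'') :: Ls).flatten.length + (q :: Q).length ∧
      (P ++ P').Subperm (((a :: p) :: (b :: p') :: (c :: p'') :: Ls).flatten ++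
        (q :: Q).flatMap (fun q => [q.1, q.2])) := by
        intro A' B' C' e1 e2 g1 g2 g3 g4
        obtain ⟨P, P', f1, f2, f3, f4⟩ := key A' B' C' g1 g2 g3 g4 rfl
        refine ⟨P, P', f1, f2, ?_, ?_⟩
        · rw [f3]
          simp at e2 ⊢; omega
        · rw [List.subperm_iff_count]
          intro x
          have := f4 x
          have := e1 x
          simp only [List.flatten_cons, List.flatMap_cons, List.count_append] at *
          omega
      rcases hq0 a Oa with ha | ha <;> rcases hq0 b Ob with hb | hb <;>
        rcases hq0 c Oc with hc | hc
      · exact fin _ _ _ (fun x => rfl) rfl hA hB hC ⟨q.1, by simp, a, p, b, p', rfl, rfl, ha, hb⟩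
      · exact fin _ _ _ (fun x => rfl) rfl hA hB hC ⟨q.1, by simp, a, p, b, p', rfl, rfl, ha, hb⟩
      · exact fin (a :: p) (c :: p'') (b :: p') (fun x => by omega) (by omega) hA hC hB
          ⟨q.1, by simp, a, p, c, p'', rfl, rfl, ha, hc⟩
      · exact fin (b :: p') (c :: p'') (a :: p) (fun x => by omega) (by omega) hB hC hA
          ⟨q.2, by simp, b, p', c, p'', rfl, rfl, hb, hc⟩
      · exact fin (b :: p') (c :: p'') (a :: p) (fun x => by omega) (by omega) hB hC hA
          ⟨q.1, by simp, b, p', c, p'', rfl, rfl, hb, hc⟩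
      · exact fin (a :: p) (c :: p'') (b :: p') (fun x => by omega) (by omega) hA hC hB
          ⟨q.2, by simp, a, p, c, p'', rfl, rfl, ha, hc⟩
      · exact fin _ _ _ (fun x => rfl) rfl hA hB hC ⟨q.2, by simp, a, p, b, p', rfl, rfl, ha, hb⟩
      · exact fin _ _ _ (fun x => rfl) rfl hA hB hC ⟨q.2, by simp, a, p, b, p', rfl, rfl, ha, hb⟩

/-- disjoint consecutive pairs -/
def pairUp {V : Type*} : List V → List (V × V)
  | a :: b :: t => (a, b) :: pairUp t
  | _ => []

lemma pairUp_length {V : Type*} : ∀ (l : List V), (pairUp l).length = l.length / 2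
  | a :: b :: t => by simp only [pairUp, List.length_cons, pairUp_length t]; omega
  | [a] => by simp [pairUp]
  | [] => by simp [pairUp]

lemma pairUp_sub {V : Type*} : ∀ (l : List V), ((pairUp l).flatMap (fun q => [q.1, q.2])).Sublist l
  | a :: b :: t => by simpa [pairUp] using pairUp_sub t
  | [a] => by simp [pairUp]
  | [] => by simp [pairUp]

lemma pairUp_mem {V : Type*} : ∀ (l : List V) (q), q ∈ pairUp l → ∃ u w, l = u ++ q.1 :: q.2 :: w
  | a :: b :: t, q, h => by
    simp only [pairUp, List.mem_cons] at h
    rcases h with rfl | h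
    · exact ⟨[], t, rfl⟩
    · obtain ⟨u, w, rfl⟩ := pairUp_mem t q h
      exact ⟨a :: b :: u, w, rfl⟩
  | [a], q, h => by simp [pairUp] at h
  | [], q, h => by simp [pairUp] at h

lemma GG_step {V : Type*} [Fintype V] (R : SimpleGraph V) (k : ℕ) (hk : 3 ≤ k)
    (hV : k - 1 + k / 2 ≤ Fintype.card V) (h : (PL R (k - 1)).Nonempty)
    (hno : ¬ (PL R k).Nonempty) : (PL Rᶜ k).Nonempty := by
  classical
  obtain ⟨X, hX1, hX2, hX3⟩ := h
  have hno' : ∀ l : List V, l.length = k → l.Nodup → l.IsChain R.Adj → False := fun l h1 h2 h3 =>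
    hno ⟨l, h1, h2, h3⟩
  obtain ⟨O, hO1, hO2, hO3⟩ : ∃ O : List V, O.length = k / 2 ∧ O.Nodup ∧ ∀ o ∈ O, o ∉ X := by
    refine ⟨((univ \ X.toFinset).toList).take (k / 2), ?_, ?_, ?_⟩
    · rw [List.length_take, Finset.length_toList, Finset.card_sdiff_of_subset (by simp)]
      rw [List.toFinset_card_of_nodup hX2, Finset.card_univ]
      omega
    · exact (Finset.nodup_toList _).sublist (List.take_sublist _ _)
    · intro o ho
      have := List.mem_of_mem_take ho
      simpa using this
  obtain ⟨x1, mid, xl, rfl⟩ : ∃ x1 mid xl, X = x1 :: (mid ++ [xl]) := by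
    cases X with
    | nil => simp at hX1; omega
    | cons a t =>
      rcases List.eq_nil_or_concat t with rfl | ⟨m, b, rfl⟩
      · simp at hX1; omega
      · exact ⟨a, m, b, by simp⟩
  have b1 : ∀ o ∈ O, Rᶜ.Adj o x1 := by
    intro o ho
    have hn := hO3 o ho
    rw [SimpleGraph.compl_adj]
    refine ⟨by rintro rfl; simp at hn, fun hadj => ?_⟩
    apply hno' (o :: x1 :: (mid ++ [xl]))
    · rw [List.length_cons, hX1]; omega
    · exact List.nodup_cons.2 ⟨hn, hX2⟩
    · exact List.isChain_cons_cons.2 ⟨hadj, hX3⟩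
  have b2 : ∀ o ∈ O, Rᶜ.Adj o xl := by
    intro o ho
    have hn := hO3 o ho
    rw [SimpleGraph.compl_adj]
    refine ⟨by rintro rfl; simp at hn, fun hadj => ?_⟩
    apply hno' ((x1 :: (mid ++ [xl])) ++ [o])
    · rw [List.length_append, hX1]; simp; omega
    · rw [List.nodup_append]
      refine ⟨hX2, by simp, ?_⟩
      intro a ha b hb
      simp only [List.mem_singleton] at hb
      rintro rfl; subst hb; exact hn ha
    · rw [List.isChain_append]
      refine ⟨hX3, by simp, ?_⟩
      intro x hx y hy
      have : (x1 :: (mid ++ [xl])).getLast? = some xl := by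
        rw [← List.cons_append, List.getLast?_append]; simp
      rw [this] at hx
      simp at hx hy
      subst hx; subst hy; exact hadj.symm
  have b3 : ∀ u z z' w, x1 :: (mid ++ [xl]) = u ++ z :: z' :: w → ∀ o ∈ O, Rᶜ.Adj o z ∨ Rᶜ.Adj o z' := by
    intro u z z' w e o ho
    have hn := hO3 o ho
    rw [e] at hn hX1 hX2 hX3
    have n1 : o ≠ z := by rintro rfl; simp at hn
    have n2 : o ≠ z' := by rintro rfl; simp at hn
    by_contra hcon
    simp only [SimpleGraph.compl_adj, not_or, not_and, not_not] at hcon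
    have a1 := hcon.1 n1
    have a2 := hcon.2 n2
    apply hno' (u ++ z :: o :: z' :: w)
    · simp at hX1 ⊢; omega
    · rw [List.nodup_iff_count_le_one] at hX2 ⊢
      intro x
      have := hX2 x
      have h0 : (u ++ z :: z' :: w).count o = 0 := List.count_eq_zero.2 hn
      by_cases hx : x = o
      · subst hx
        simp only [List.count_append, List.count_cons] at h0 ⊢
        simp [Ne.symm n1, Ne.symm n2] at h0 ⊢
        simp [h0]
      · simp [List.count_append, List.count_cons, Ne.symm hx] at this ⊢
        omega
    · rw [List.isChain_append] at hX3 ⊢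
      refine ⟨hX3.1, ?_, ?_⟩
      · have := hX3.2.1
        rw [List.isChain_cons_cons] at this
        exact List.isChain_cons_cons.2 ⟨a1.symm, List.isChain_cons_cons.2 ⟨a2, this.2⟩⟩
      · intro x hx y hy
        exact hX3.2.2 x hx y (by simpa using hy)
  have hmid : mid.length = k - 3 := by simp at hX1; omega
  have hpair : ∀ q ∈ pairUp mid, ∀ o, o ∈ O → Rᶜ.Adj o q.1 ∨ Rᶜ.Adj o q.2 := by
    intro q hq o ho
    obtain ⟨u, w, e⟩ := pairUp_mem mid q hq
    exact b3 (x1 :: u) q.1 q.2 (w ++ [xl]) (by rw [e]; simp) o ho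
  have hpl := pairUp_length mid
  have hps := pairUp_sub mid
  -- nodup of everything
  have hall : (O ++ x1 :: (mid ++ [xl])).Nodup := by
    rw [List.nodup_append]
    refine ⟨hO2, hX2, ?_⟩
    rintro a ha b hb rfl
    exact hO3 a ha hb
  by_cases hk3 : k = 3
  · subst hk3
    obtain ⟨o, rfl⟩ := List.length_eq_one_iff.1 hO1
    refine ⟨[x1, o, xl], rfl, ?_, ?_⟩
    · have hm : mid = [] := by simpa using hmid
      subst hm
      rw [List.nodup_iff_count_le_one] at hall ⊢
      intro x
      have := hall x
      simp [List.count_cons] at this ⊢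
      omega
    · have h1 := b1 o (by simp)
      have h2 := b2 o (by simp)
      exact List.isChain_cons_cons.2 ⟨h1.symm, List.isChain_cons_cons.2 ⟨h2, by simp⟩⟩
  · -- the merging
    have hmerge := GP_merge (G := Rᶜ) (O := fun o => o ∈ O) ((pairUp mid).drop ((pairUp mid).length - (k / 2 - 2)))
      (O.map (fun o => [o])) (by
        rw [List.length_map, List.length_drop, hO1]; omega) (by
        intro P hP
        obtain ⟨o, ho, rfl⟩ := List.mem_map.1 hP
        exact ⟨by simp, ⟨o, [], rfl, ho⟩, ⟨o, [], rfl, ho⟩⟩)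
        (fun q hq => hpair q (List.mem_of_mem_drop hq))
    have hfl : (O.map (fun o => [o])).flatten = O := by
      clear * -
      induction O with
      | nil => rfl
      | cons a t ih => simp [ih]
    obtain ⟨P, P', hP, hP', hlen, hsub⟩ := hmerge
    rw [hfl] at hlen hsub
    rw [List.length_drop, hO1] at hlen
    obtain ⟨p1, ⟨a, p, rfl, ha⟩, ⟨c, q, hc, hcO⟩⟩ := hP
    obtain ⟨p1', ⟨a', p', rfl, ha'⟩, ⟨c', q', hc', hcO'⟩⟩ := hP'
    have hcnt := List.subperm_iff_count.1 hsub
    -- main blue path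
    have hch : (xl :: ((a :: p).reverse ++ x1 :: a' :: p')).IsChain Rᶜ.Adj := by
      rw [List.isChain_cons]
      constructor
      · rw [hc]; simp
        have := (b2 c hcO).symm
        simpa using this
      · rw [List.isChain_append]
        refine ⟨?_, ?_, ?_⟩
        · rw [List.isChain_reverse]
          exact p1.imp (fun a b hab => hab.symm)
        · rw [List.isChain_cons_cons]; exact ⟨(b1 a' ha').symm, p1'⟩
        · have := b1 a ha
          simpa using this
    by_cases hodd : k % 2 = 0
    · refine ⟨_, ?_, ?_, hch⟩
      · simp at hlen ⊢; omega
      · rw [List.nodup_iff_count_le_one] at hall ⊢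
        intro x
        have h1 := hall x
        have h2 := hcnt x
        have h3 := ((List.drop_sublist ((pairUp mid).length - (k / 2 - 2)) (pairUp mid)).flatMap (fun q : V × V => [q.1, q.2])).trans hps |>.count_le x
        simp [List.count_append, List.count_cons] at h1 h2 h3 ⊢
        omega
    · -- one leftover pair
      have e : pairUp mid = (pairUp mid).take 1 ++ (pairUp mid).drop ((pairUp mid).length - (k / 2 - 2)) := by
        have : (pairUp mid).length - (k / 2 - 2) = 1 := by omega
        rw [this, List.take_append_drop]
      obtain ⟨q0, hq0⟩ : ∃ q0, (pairUp mid).take 1 = [q0] := by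
        apply List.length_eq_one_iff.1
        rw [List.length_take]; omega
      rw [hq0] at e
      have hq0m : q0 ∈ pairUp mid := by rw [e]; simp
      obtain ⟨y, hy, hyadj⟩ : ∃ y, (y = q0.1 ∨ y = q0.2) ∧ Rᶜ.Adj c' y := by
        rcases hpair q0 hq0m c' hcO' with h | h
        · exact ⟨_, Or.inl rfl, h⟩
        · exact ⟨_, Or.inr rfl, h⟩
      refine ⟨(xl :: ((a :: p).reverse ++ x1 :: a' :: p')) ++ [y], ?_, ?_, ?_⟩
      · simp at hlen ⊢; omega
      · rw [List.nodup_iff_count_le_one] at hall ⊢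
        intro x
        have h1 := hall x
        have h2 := hcnt x
        have h3 := hps.count_le x
        rw [e] at h3
        have hyy : [y].count x ≤ [q0.1, q0.2].count x := by
          rcases hy with rfl | rfl <;> simp [List.count_cons]
        rw [List.flatMap_append, List.count_append] at h3
        simp [List.count_append, List.count_cons] at hyy h1 h2 h3 ⊢
        omega
      · rw [List.isChain_append]
        refine ⟨hch, by simp, ?_⟩
        rw [hc']
        have : (xl :: ((a :: p).reverse ++ x1 :: (q' ++ [c']))).getLast? = some c' := by
          rw [show xl :: ((a :: p).reverse ++ x1 :: (q' ++ [c'])) = (xl :: ((a :: p).reverse ++ x1 :: q')) ++ [c'] by simp, List.getLast?_append]; simp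
        rw [this]
        simpa using hyadj

lemma GG {V : Type*} [Fintype V] (R : SimpleGraph V) (k : ℕ) (hk : 2 ≤ k)
    (hV : k - 1 + k / 2 ≤ Fintype.card V) : (PL R k).Nonempty ∨ (PL Rᶜ k).Nonempty := by
  classical
  induction k, hk using Nat.le_induction with
  | base =>
    obtain ⟨a, b, hab⟩ := Fintype.one_lt_card_iff.1 (show 1 < Fintype.card V by omega)
    by_cases h : R.Adj a b
    · exact Or.inl ⟨[a, b], rfl, by simpa using hab, by simpa using h⟩
    · exact Or.inr ⟨[a, b], rfl, by simpa using hab, by simp [h, hab]⟩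
  | succ k hk ih =>
    by_cases h1 : (PL R (k+1)).Nonempty
    · exact Or.inl h1
    · rcases ih (by omega) with h | h
      · exact Or.inr (GG_step R (k+1) (by omega) hV h h1)
      · by_cases h2 : (PL Rᶜ (k+1)).Nonempty
        · exact Or.inr h2
        · have := GG_step Rᶜ (k+1) (by omega) hV h h2
          rw [compl_compl] at this
          exact Or.inl this

open Classical in
/-- One-sided regularity: large subsets have density at least `d`. -/
def DensePair {V : Type*} (G : SimpleGraph V) (ε d : ℝ) (S T : Finset V) : Prop :=
  ∀ S' ⊆ S, ∀ T' ⊆ T, ε * (#S : ℝ) ≤ #S' → ε * (#T : ℝ) ≤ #T' →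
    d * #S' * #T' ≤ ∑ x ∈ S', (#{y ∈ T' | G.Adj x y} : ℝ)

open Classical in
lemma DensePair.choose {V : Type*} {G : SimpleGraph V} {ε d : ℝ} {S T : Finset V}
    (h : DensePair G ε d S T) (hS : 0 < ε * (#S : ℝ)) {U W : Finset V} (hU : U ⊆ S) (hW : W ⊆ T)
    (hWc : ε * (#T : ℝ) ≤ #W) :
    (#U : ℝ) - ε * #S ≤ #{x ∈ U | d * (#W : ℝ) ≤ #{y ∈ W | G.Adj x y}} := by
  by_contra hcon
  push Not at hcon
  have h1 := Finset.card_filter_add_card_filter_not (s := U) (fun x => d * (#W : ℝ) ≤ #{y ∈ W | G.Adj x y})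
  set B := {x ∈ U | ¬ d * (#W : ℝ) ≤ #{y ∈ W | G.Adj x y}} with hB
  have h1' : (#{x ∈ U | d * (#W : ℝ) ≤ #{y ∈ W | G.Adj x y}} : ℝ) + #B = #U := by exact_mod_cast h1
  have hBc : ε * (#S : ℝ) ≤ #B := by linarith
  have h2 := h B ((filter_subset _ _).trans hU) W hW hBc hWc
  have hne : B.Nonempty := by
    rw [← Finset.card_pos]
    have : (0:ℝ) < #B := by linarith
    exact_mod_cast this
  have h3 : ∑ x ∈ B, (#{y ∈ W | G.Adj x y} : ℝ) < ∑ x ∈ B, d * (#W : ℝ) := by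
    apply Finset.sum_lt_sum_of_nonempty hne
    intro x hx
    simp only [hB, mem_filter, not_le] at hx
    exact hx.2
  rw [Finset.sum_const, nsmul_eq_mul] at h3
  linarith [mul_assoc d (#B : ℝ) (#W : ℝ), mul_left_comm d (#B : ℝ) (#W : ℝ)]

open Classical in
lemma walk_paths {V ι : Type*} [Fintype V] (G : SimpleGraph V) (Vc : ι → Finset V)
    (hdisj : ∀ i j, i ≠ j → Disjoint (Vc i) (Vc j)) (m : ℕ) (hm : 0 < m)
    (hVc : ∀ i, m ≤ #(Vc i) ∧ #(Vc i) ≤ 2 * m) (k : ℕ) (w : ℕ → ι) (ε d β : ℝ)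
    (hw : ∀ a, a + 1 < k → w a ≠ w (a+1) ∧ DensePair G ε d (Vc (w a)) (Vc (w (a+1))))
    (hcount : ∀ i, (#{a ∈ range k | w a = i} : ℝ) ≤ (1 - β) * m)
    (hε : 0 < ε) (hd : 0 < d) (hd1 : d ≤ 1) (hβ : 0 < β) (hβ1 : β ≤ 1) (hεd : ε ≤ d * β / 4) :
    ((d * β / 2) * m) ^ k ≤ ((PL G k).ncard : ℝ) := by
  have hm' : (0:ℝ) < m := by exact_mod_cast hm
  have hdβ : 0 < d * β := by positivity
  have hdβ1 : d * β ≤ β := by nlinarith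
  let cand : List V → Finset V := fun l => {x ∈ Vc (w l.length) | x ∉ l ∧ ∀ h ∈ l.head?, G.Adj h x}
  let Inv : List V → Prop := fun l => l.Nodup ∧ l.IsChain G.Adj ∧
    (∀ i, #{x ∈ Vc i | x ∈ l} ≤ #{a ∈ range l.length | w a = i}) ∧
    (l.length < k → d * β * m ≤ #(cand l))
  have key := tree_cons Inv (fun _ => d * β / 2 * m) (fun _ => by positivity)
    (by
      refine ⟨by simp, by simp, by simp, ?_⟩
      intro _
      have : cand [] = Vc (w 0) := by simp [cand]
      rw [this]
      have := (hVc (w 0)).1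
      have : (m:ℝ) ≤ #(Vc (w 0)) := by exact_mod_cast this
      nlinarith) k
    (by
      intro l hl hlk
      obtain ⟨h1, h2, h3, h4⟩ := hl
      have h4 := h4 hlk
      rw [Set.ncard_eq_toFinset_card']
      -- consequences for any candidate
      have hadd : ∀ x ∈ cand l, (x :: l).Nodup ∧ (x :: l).IsChain G.Adj ∧
          (∀ i, #{y ∈ Vc i | y ∈ x :: l} ≤ #{a ∈ range (x :: l).length | w a = i}) := by
        intro x hx
        simp only [cand, mem_filter] at hx
        obtain ⟨hx1, hx2, hx3⟩ := hx
        refine ⟨List.nodup_cons.2 ⟨hx2, h1⟩, List.isChain_cons.2 ⟨fun y hy => (hx3 y hy).symm, h2⟩, ?_⟩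
        intro i
        rw [List.length_cons, Finset.range_add_one, Finset.filter_insert]
        by_cases hi : w l.length = i
        · rw [if_pos hi, Finset.card_insert_of_notMem (by simp)]
          have : {y ∈ Vc i | y ∈ x :: l} ⊆ insert x {y ∈ Vc i | y ∈ l} := by
            intro y hy
            simp only [mem_filter, List.mem_cons, mem_insert] at hy ⊢
            tauto
          exact (Finset.card_le_card this).trans ((Finset.card_insert_le _ _).trans
            (Nat.add_le_add_right (h3 i) 1))
        · rw [if_neg hi]
          have : {y ∈ Vc i | y ∈ x :: l} ⊆ {y ∈ Vc i | y ∈ l} := by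
            intro y hy
            simp only [mem_filter, List.mem_cons] at hy ⊢
            refine ⟨hy.1, hy.2.resolve_left ?_⟩
            rintro rfl
            exact Finset.disjoint_left.1 (hdisj _ _ hi) hx1 hy.1
          exact (Finset.card_le_card this).trans (h3 i)
      by_cases hlast : l.length + 1 < k
      · obtain ⟨hne, hdp⟩ := hw _ hlast
        let W : Finset V := {y ∈ Vc (w (l.length + 1)) | y ∉ l}
        have hWc : β * m ≤ (#W : ℝ) := by
          have e1 := Finset.card_filter_add_card_filter_not (s := Vc (w (l.length + 1))) (fun y => y ∈ l)
          have e2 := (hVc (w (l.length + 1))).1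
          have e3 := h3 (w (l.length + 1))
          have e4 : #{a ∈ range l.length | w a = w (l.length + 1)} ≤
              #{a ∈ range k | w a = w (l.length + 1)} := by
            apply Finset.card_le_card
            apply Finset.filter_subset_filter
            intro a ha
            simp at ha ⊢; omega
          have e5 := hcount (w (l.length + 1))
          have e6 : (#{x ∈ Vc (w (l.length + 1)) | x ∈ l} : ℝ) ≤ (1 - β) * m :=
            le_trans (by exact_mod_cast e3.trans e4) e5
          have e7 : (m:ℝ) ≤ #{x ∈ Vc (w (l.length + 1)) | x ∈ l} + #W := by
            have : m ≤ #{x ∈ Vc (w (l.length + 1)) | x ∈ l} + #W := by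
              rw [e1]; exact e2
            exact_mod_cast this
          linarith
        have hV1 := hVc (w l.length)
        have hV2 := hVc (w (l.length + 1))
        have r1 : (m:ℝ) ≤ #(Vc (w l.length)) := by exact_mod_cast hV1.1
        have r2 : (#(Vc (w l.length)) : ℝ) ≤ 2 * m := by exact_mod_cast hV1.2
        have r3 : (#(Vc (w (l.length+1))) : ℝ) ≤ 2 * m := by exact_mod_cast hV2.2
        have hch := hdp.choose (U := cand l) (W := W) (by
            have : (0:ℝ) < #(Vc (w l.length)) := by linarith
            positivity)
          (filter_subset _ _) (filter_subset _ _) (by nlinarith)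
        have hle : (d * β / 2 * m) ≤ (#{x ∈ cand l | d * (#W : ℝ) ≤ #{y ∈ W | G.Adj x y}} : ℝ) := by
          nlinarith
        refine hle.trans ?_
        norm_cast
        apply Finset.card_le_card
        intro x hx
        rw [mem_filter] at hx
        simp only [Set.mem_toFinset, Set.mem_setOf_eq]
        obtain ⟨g1, g2, g3⟩ := hadd x hx.1
        refine ⟨g1, g2, g3, fun _ => ?_⟩
        have hsub : {y ∈ W | G.Adj x y} ⊆ cand (x :: l) := by
          intro y hy
          simp only [W, cand, mem_filter, List.length_cons, List.mem_cons, List.head?_cons,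
            Option.mem_def, Option.some.injEq] at hy ⊢
          refine ⟨hy.1.1, ?_, ?_⟩
          · rintro (rfl | h)
            · exact hy.2.ne rfl
            · exact hy.1.2 h
          · rintro h rfl; exact hy.2
        have : (#{y ∈ W | G.Adj x y} : ℝ) ≤ #(cand (x :: l)) := by
          exact_mod_cast Finset.card_le_card hsub
        nlinarith [hx.2]
      · have hle : (d * β / 2 * m) ≤ (#(cand l) : ℝ) := by nlinarith
        refine hle.trans ?_
        norm_cast
        apply Finset.card_le_card
        intro x hx
        simp only [Set.mem_toFinset, Set.mem_setOf_eq]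
        obtain ⟨g1, g2, g3⟩ := hadd x hx
        refine ⟨g1, g2, g3, fun h => ?_⟩
        rw [List.length_cons] at h
        exact absurd h hlast)
  rw [Finset.prod_const, Finset.card_range] at key
  refine key.trans ?_
  norm_cast
  apply Set.ncard_le_ncard _ (PL_finite G k)
  rintro l ⟨e, h1, h2, _⟩
  exact ⟨e, h1, h2⟩

open Classical in
lemma konig_hall {ι : Type*} [Fintype ι] (Γ : SimpleGraph ι) (C : Finset ι)
    (hC : ∀ i ∈ C, ∀ j, Γ.Adj i j → j ∈ C) :
    ∃ (T : Finset ι) (σ : ι → ι) (w : ι → ℕ), T ⊆ C ∧ Set.InjOn σ T ∧ (∀ i ∈ T, Γ.Adj i (σ i)) ∧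
      (∀ i, w i ≤ 2) ∧ (∀ i ∈ C, ∀ j ∈ C, Γ.Adj i j → 2 ≤ w i + w j) ∧ ∑ i ∈ C, w i = #T := by
  let N : Finset ι → Finset ι := fun S => S.biUnion (fun i => univ.filter (Γ.Adj i))
  obtain ⟨S, hS, hmax⟩ := Finset.exists_max_image C.powerset (fun S => (#S : ℤ) - #(N S))
    ⟨∅, by simp⟩
  rw [mem_powerset] at hS
  have hd0 : (0 : ℤ) ≤ (#S : ℤ) - #(N S) := by
    have := hmax ∅ (by simp)
    simpa [N] using this
  obtain ⟨d, hd⟩ := Int.eq_ofNat_of_zero_le hd0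
  have hNC : N S ⊆ C := by
    intro j hj
    simp only [N, mem_biUnion, mem_filter, mem_univ, true_and] at hj
    obtain ⟨i, hi, hij⟩ := hj
    exact hC i (hS hi) j hij
  let t : C → Finset (ι ⊕ Fin d) := fun i => (univ.filter (Γ.Adj i)).disjSum univ
  have hall := (Finset.all_card_le_biUnion_card_iff_exists_injective t).1 (by
    intro A
    by_cases hA : A = ∅
    · simp [hA]
    have hne : A.Nonempty := Finset.nonempty_iff_ne_empty.2 hA
    have e : A.biUnion t = (N (A.map (Function.Embedding.subtype _))).disjSum univ := by
      ext x
      rcases x with x | x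
      · simp [t, N]
      · simp [t, N]
        obtain ⟨a, ha⟩ := hne
        exact ⟨a.1, a.2, ha⟩
    rw [e, Finset.card_disjSum, Finset.card_univ, Fintype.card_fin]
    have := hmax (A.map (Function.Embedding.subtype _)) (by
      rw [mem_powerset]
      intro x hx
      simp at hx
      exact hx.1)
    rw [Finset.card_map] at this
    omega)
  obtain ⟨f, hf, hft⟩ := hall
  -- the left part
  let g : ι → ι ⊕ Fin d := fun i => if h : i ∈ C then f ⟨i, h⟩ else Sum.inl i
  have hg : Set.InjOn g C := by
    intro i hi j hj hij
    have hi' : i ∈ C := hi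
    have hj' : j ∈ C := hj
    simp only [g, hi', hj', dif_pos] at hij
    simpa using hf hij
  have hgm : ∀ i ∈ C, ∀ x, g i = Sum.inl x → Γ.Adj i x := by
    intro i hi x hx
    simp only [g, hi, dif_pos] at hx
    have := hft ⟨i, hi⟩
    rw [hx] at this
    simpa [t] using this
  let T0 := C.filter (fun i => (g i).isLeft)
  have hT0 : #C ≤ #T0 + d := by
    have e1 : #T0 + #(C.filter (fun i => ¬ ((g i).isLeft : Prop))) = #C := by
      simp only [T0]
      convert Finset.card_filter_add_card_filter_not (s := C) (fun i => ((g i).isLeft : Prop))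
    have e2 : #(C.filter (fun i => ¬ ((g i).isLeft : Prop))) ≤ #(univ.map (Function.Embedding.inr : Fin d ↪ ι ⊕ Fin d)) := by
      apply Finset.card_le_card_of_injOn g
      · intro i hi
        simp at hi ⊢
        rcases h : g i with x | x
        · simp [h] at hi
        · exact ⟨x, rfl⟩
      · exact hg.mono (by intro i hi; simp at hi; exact hi.1)
    rw [Finset.card_map, Finset.card_univ, Fintype.card_fin] at e2
    omega
  have hSC := Finset.card_le_card hS
  obtain ⟨T, hT, hTc⟩ := Finset.exists_subset_card_eq (show #C - d ≤ #T0 by omega)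
  refine ⟨T, fun i => (g i).elim id (fun _ => i), fun i => (if i ∈ S then 0 else 1) + (if i ∈ N S then 1 else 0),
    hT.trans (filter_subset _ _), ?_, ?_, ?_, ?_, ?_⟩
  · intro i hi j hj hij
    have hi' := hT hi
    have hj' := hT hj
    simp only [T0, mem_filter] at hi' hj'
    apply hg hi'.1 hj'.1
    obtain ⟨x, hx⟩ := Sum.isLeft_iff.1 hi'.2
    obtain ⟨y, hy⟩ := Sum.isLeft_iff.1 hj'.2
    simp [hx, hy] at hij ⊢
    exact hij
  · intro i hi
    have hi' := hT hi
    simp only [T0, mem_filter] at hi'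
    obtain ⟨x, hx⟩ := Sum.isLeft_iff.1 hi'.2
    simp only [hx, Sum.elim_inl, id]
    exact hgm i hi'.1 x hx
  · intro i
    dsimp only
    split_ifs <;> omega
  · intro i hi j hj hij
    have h1 : i ∈ S → j ∈ N S := fun h => by
      simp only [N, mem_biUnion, mem_filter, mem_univ, true_and]; exact ⟨i, h, hij⟩
    have h2 : j ∈ S → i ∈ N S := fun h => by
      simp only [N, mem_biUnion, mem_filter, mem_univ, true_and]; exact ⟨j, h, hij.symm⟩
    dsimp only
    split_ifs <;> simp_all
  · rw [Finset.sum_add_distrib]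
    have e1 : ∑ i ∈ C, (if i ∈ S then 0 else 1) = #C - #S := by
      rw [← Finset.card_sdiff_of_subset hS, Finset.card_eq_sum_ones, ← Finset.filter_notMem_eq_sdiff, Finset.sum_filter]
      simp
    have e2 : ∑ i ∈ C, (if i ∈ N S then 1 else 0) = #(N S) := by
      rw [← Finset.card_filter, Finset.filter_mem_eq_inter, Finset.inter_eq_right.2 hNC]
    rw [e1, e2, hTc]
    omega

lemma block_chain {ι : Type*} (Γ : SimpleGraph ι) (i j : ι) (h : Γ.Adj i j) (X : List ι)
    (hX : X.IsChain Γ.Adj) (hh : ∀ x ∈ X.head?, Γ.Adj j x) (q : ℕ) :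
    ((List.replicate q [i, j]).flatten ++ X).IsChain Γ.Adj ∧
      ∀ x ∈ ((List.replicate q [i, j]).flatten ++ X).head?, Γ.Adj j x := by
  induction q with
  | zero => exact ⟨by simpa using hX, by simpa using hh⟩
  | succ q ih =>
    rw [List.replicate_succ, List.flatten_cons]
    constructor
    · simp only [List.cons_append, List.nil_append]
      rw [List.isChain_cons_cons, List.isChain_cons]
      exact ⟨h, ih.2, ih.1⟩
    · simpa using h.symm

lemma closed_walk {ι : Type*} [DecidableEq ι] (Γ : SimpleGraph ι) (q : ℕ) (hq : 1 ≤ q) (σ : ι → ι) (Ts : List ι)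
    (hadj : ∀ i ∈ Ts, Γ.Adj i (σ i)) (hreach : ∀ i ∈ Ts, ∀ j ∈ Ts, Γ.Reachable i j) :
    ∃ L : List ι, L.IsChain Γ.Adj ∧ 2 * q * Ts.length ≤ L.length ∧ (∀ a ∈ L.head?, a ∈ Ts) ∧
      ∀ i, L.count i ≤ q * Ts.count i + q * (Ts.map σ).count i + Ts.length := by
  induction Ts with
  | nil => exact ⟨[], by simp⟩
  | cons t Ts ih =>
    obtain ⟨L, h1, h2, h3, h4⟩ := ih (fun i hi => hadj i (by simp [hi]))
      (fun i hi j hj => hreach i (by simp [hi]) j (by simp [hj]))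
    have hcon : ∃ X : List ι, X.IsChain Γ.Adj ∧ (∀ x ∈ X.head?, x = t) ∧ L.length ≤ X.length ∧
        ∀ i, X.count i ≤ L.count i + 1 := by
      cases L with
      | nil => exact ⟨[], by simp⟩
      | cons a L =>
        have ha : a ∈ Ts := h3 a (by simp)
        obtain ⟨p, hp⟩ := (hreach t (by simp) a (by simp [ha])).exists_isPath
        have hs : p.support.dropLast ++ [a] = p.support := by
          have := List.dropLast_append_getLast p.support_ne_nil
          rwa [SimpleGraph.Walk.getLast_support] at this
        have hh : p.support.head? = some t := by cases p <;> simp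
        have hc : p.support.IsChain Γ.Adj := p.isChain_adj_support
        refine ⟨p.support.dropLast ++ a :: L, ?_, ?_, by simp, ?_⟩
        · rw [← hs, List.isChain_append] at hc
          rw [List.isChain_append]
          exact ⟨hc.1, h1, fun x hx y hy => hc.2.2 x hx y (by simpa using hy)⟩
        · rw [← hs] at hh
          intro x hx
          cases hd : p.support.dropLast with
          | nil => rw [hd] at hh hx; simp at hh hx; rw [← hx, hh]
          | cons b l => rw [hd] at hh hx; simp at hh hx; rw [← hx, hh]
        · intro i
          have : p.support.dropLast.count i ≤ 1 := 
            List.nodup_iff_count_le_one.1 (hp.support_nodup.sublist (List.dropLast_sublist _)) i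
          rw [List.count_append]; omega
    obtain ⟨X, x1, x2, x3, x4⟩ := hcon
    have hb := block_chain Γ t (σ t) (hadj t (by simp)) X x1
      (fun x hx => by rw [x2 x hx]; exact (hadj t (by simp)).symm) q
    refine ⟨_, hb.1, ?_, ?_, ?_⟩
    · simp
      nlinarith
    · intro a ha
      obtain ⟨q, rfl⟩ := Nat.exists_eq_add_of_le' hq
      rw [List.replicate_succ, List.flatten_cons] at ha
      simp at ha; simp [ha]
    · intro i
      have := h4 i
      have := x4 i
      have e : (List.replicate q [t, σ t]).flatten.count i = q * [t, σ t].count i := by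
        clear * -
        induction q with
        | zero => simp
        | succ q ih => rw [List.replicate_succ, List.flatten_cons, List.count_append, ih]; ring
      rw [List.count_append, e, List.map_cons]
      simp only [List.count_cons, List.length_cons, List.count_nil] at *
      nlinarith

lemma walk_fun {ι : Type*} [DecidableEq ι] (L : List ι) (i0 : ι) (k : ℕ) (hk : k ≤ L.length) (i : ι) :
    #{a ∈ range k | L.getD a i0 = i} ≤ L.count i := by
  have : #{a ∈ range k | L.getD a i0 = i} = (L.take k).count i := by
    induction k with
    | zero => simp
    | succ k ih =>
      have hk' : k < L.length := hk
      rw [Finset.range_add_one, Finset.filter_insert, ← List.take_append_getElem hk', List.count_append, ← ih hk'.le]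
      have e : L.getD k i0 = L[k] := by simp [hk']
      rw [e]
      split_ifs with h
      · rw [Finset.card_insert_of_notMem (by simp)]; simp [h]
      · simp [h]
  rw [this]
  exact (List.take_sublist k L).count_le i

open Classical in
/-- Packaged: a long walk in a component with a large fractional matching. -/
lemma walk_of_matching {ι : Type*} [Fintype ι] (Γ : SimpleGraph ι) (T : Finset ι) (σ : ι → ι)
    (hT : T.Nonempty) (hσ : Set.InjOn σ T) (hadj : ∀ i ∈ T, Γ.Adj i (σ i))
    (hreach : ∀ i ∈ T, ∀ j ∈ T, Γ.Reachable i j) (q : ℕ) (hq : 1 ≤ q) (k : ℕ) (hk : k ≤ 2 * q * #T) :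
    ∃ w : ℕ → ι, (∀ a, a + 1 < k → Γ.Adj (w a) (w (a+1))) ∧
      ∀ i, #{a ∈ range k | w a = i} ≤ 2 * q + #T := by
  obtain ⟨i0, _⟩ := hT
  obtain ⟨L, h1, h2, h3, h4⟩ := closed_walk Γ q hq σ T.toList (by simpa using hadj) (by simpa using hreach)
  rw [Finset.length_toList] at h2
  refine ⟨fun a => L.getD a i0, ?_, ?_⟩
  · intro a ha
    have := List.isChain_iff_getElem.1 h1 a (by omega)
    have e1 : L.getD a i0 = L[a] := by simp [show a < L.length by omega]
    have e2 : L.getD (a+1) i0 = L[a+1] := by simp [show a + 1 < L.length by omega]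
    change Γ.Adj (L.getD a i0) (L.getD (a+1) i0)
    rw [e1, e2]; exact this
  · intro i
    refine (walk_fun L i0 k (by omega) i).trans ((h4 i).trans ?_)
    have n1 : T.toList.count i ≤ 1 := List.nodup_iff_count_le_one.1 (Finset.nodup_toList T) i
    have n2 : (T.toList.map σ).count i ≤ 1 := by
      apply List.nodup_iff_count_le_one.1
      apply List.Nodup.map_on _ (Finset.nodup_toList T)
      intro x hx y hy e
      simp at hx hy
      exact hσ hx hy e
    rw [Finset.length_toList]
    nlinarith

/-- component with a large fractional matching -/
def LongM {ι : Type*} (Γ : SimpleGraph ι) (τ : ℝ) : Prop :=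
  ∃ (T : Finset ι) (σ : ι → ι), τ ≤ #T ∧ Set.InjOn σ T ∧ (∀ i ∈ T, Γ.Adj i (σ i)) ∧
    ∀ i ∈ T, ∀ j ∈ T, Γ.Reachable i j

/-- near-extremal structure -/
def ExtS {ι : Type*} (Γ Γ' : SimpleGraph ι) (a b : ℝ) : Prop :=
  ∃ A B : Finset ι, Disjoint A B ∧ a ≤ #A ∧ b ≤ #B ∧ (∀ x ∈ A, ∀ y ∈ A, ¬ Γ.Adj x y) ∧
    ∀ x ∈ A, ∀ y ∈ B, ¬ Γ'.Adj x y

open Classical in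
lemma comp_cover {ι : Type*} [Fintype ι] (Γ : SimpleGraph ι) (τ : ℝ) (z : ι) :
    LongM Γ τ ∨ ∃ w : ι → ℕ, (∀ i j, Γ.Reachable z i → Γ.Adj i j → 2 ≤ w i + w j) ∧
      ∑ i ∈ univ.filter (fun i => Γ.Reachable z i), (w i : ℝ) < τ := by
  have hC : ∀ i ∈ univ.filter (fun i => Γ.Reachable z i), ∀ j, Γ.Adj i j →
      j ∈ univ.filter (fun i => Γ.Reachable z i) := by
    intro i hi j hij
    simp only [mem_filter, mem_univ, true_and] at hi ⊢
    exact hi.trans hij.reachable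
  obtain ⟨T, σ, w, h1, h2, h3, h4, h5, h6⟩ := konig_hall Γ (univ.filter (fun i => Γ.Reachable z i)) hC
  by_cases h : τ ≤ #T
  · left
    refine ⟨T, σ, h, h2, h3, ?_⟩
    intro i hi j hj
    have hi := h1 hi
    have hj := h1 hj
    simp only [mem_filter, mem_univ, true_and] at hi hj
    exact hi.symm.trans hj
  · right
    refine ⟨w, ?_, ?_⟩
    · intro i j hi hij
      exact h5 i (by simpa using hi) j (by simpa using hi.trans hij.reachable) hij
    · rw [← Nat.cast_sum, h6]; exact not_le.1 h

open Classical in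
/-- bad pairs -/
noncomputable def badP {ι : Type*} [Fintype ι] (Γr Γb : SimpleGraph ι) : Finset (ι × ι) :=
  univ.filter (fun p => ¬ Γr.Adj p.1 p.2 ∧ ¬ Γb.Adj p.1 p.2)

lemma bad_rect {ι : Type*} [Fintype ι] {Γr Γb : SimpleGraph ι} {X Y : Finset ι}
    (h : ∀ x ∈ X, ∀ y ∈ Y, ¬ Γr.Adj x y ∧ ¬ Γb.Adj x y) :
    (#X : ℝ) * #Y ≤ #(badP Γr Γb) := by
  classical
  norm_cast
  rw [← Finset.card_product]
  apply Finset.card_le_card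
  intro p hp
  rw [mem_product] at hp
  simpa [badP] using h _ hp.1 _ hp.2

open Classical in
lemma bad_avg {ι : Type*} [Fintype ι] (Γr Γb : SimpleGraph ι) (X : Finset ι) (hX : X.Nonempty) :
    ∃ x ∈ X, (#X : ℝ) * #{y | ¬ Γr.Adj x y ∧ ¬ Γb.Adj x y} ≤ #(badP Γr Γb) := by
  obtain ⟨x, hx, hmin⟩ := Finset.exists_min_image X (fun x => #{y | ¬ Γr.Adj x y ∧ ¬ Γb.Adj x y}) hX
  refine ⟨x, hx, ?_⟩
  have h1 : #X * #{y | ¬ Γr.Adj x y ∧ ¬ Γb.Adj x y} ≤ ∑ z ∈ X, #{y | ¬ Γr.Adj z y ∧ ¬ Γb.Adj z y} := by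
    rw [← smul_eq_mul]
    exact Finset.card_nsmul_le_sum _ _ _ hmin
  have h2 : ∑ z ∈ X, #{y | ¬ Γr.Adj z y ∧ ¬ Γb.Adj z y} ≤ #(badP Γr Γb) := by
    rw [← Finset.card_sigma]
    apply Finset.card_le_card_of_injOn (fun p => (p.1, p.2))
    · rintro ⟨a, b⟩ h
      simp [badP] at h ⊢
      exact h.2
    · rintro ⟨a, b⟩ _ ⟨a', b'⟩ _ h
      simp at h; obtain ⟨rfl, rfl⟩ := h; rfl
  exact_mod_cast h1.trans h2

set_option maxHeartbeats 2000000 in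
open Classical in
lemma stab_half {ι : Type*} [Fintype ι] (Γr Γb : SimpleGraph ι) (κ t : ℝ) (ht : 0 < t)
    (hκ : 0 < κ) (hκ1 : κ ≤ 1/1000) 
    (hbad : (#(badP Γr Γb) : ℝ) ≤ κ^2 * t^2) (i0 : ι)
    (hD : (1 - 2 * κ) * t ≤ #(univ.filter (fun i => Γb.Reachable i0 i))) :
    LongM Γr ((2/3 + κ) * t) ∨ LongM Γb ((2/3 + κ) * t) ∨
    ExtS Γr Γb ((2/3 - 11 * κ) * t) ((1/3 - 4 * κ) * t) ∨
    ExtS Γb Γr ((2/3 - 11 * κ) * t) ((1/3 - 4 * κ) * t) := by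
  rcases comp_cover Γb ((2/3 + κ) * t) i0 with h | ⟨wb, hwb, hwbs⟩
  · exact Or.inr (Or.inl h)
  set D := univ.filter (fun i => Γb.Reachable i0 i) with hDdef
  have memD : ∀ i, i ∈ D ↔ Γb.Reachable i0 i := by simp [hDdef]
  -- counting zeros
  have zeros : ∀ (w : ι → ℕ) (S S' : Finset ι), (∀ i ∈ S, i ∉ S' → w i = 0) →
      (#S : ℝ) - ∑ i ∈ S', (w i : ℝ) ≤ #(S.filter (fun i => w i = 0)) := by
    intro w S S' h
    have h1 : #S ≤ #(S.filter (fun i => w i = 0)) + ∑ i ∈ S', w i := by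
      have e1 := Finset.card_filter_add_card_filter_not (s := S) (fun i => w i = 0)
      have e2 : #(S.filter (fun i => ¬ w i = 0)) ≤ ∑ i ∈ S', w i := by
        calc #(S.filter (fun i => ¬ w i = 0)) = ∑ i ∈ S.filter (fun i => ¬ w i = 0), 1 := by simp
          _ ≤ ∑ i ∈ S.filter (fun i => ¬ w i = 0), w i := by
            apply Finset.sum_le_sum
            intro i hi
            simp at hi; omega
          _ ≤ ∑ i ∈ S', w i := by
            apply Finset.sum_le_sum_of_subset
            intro i hi
            simp only [mem_filter] at hi
            by_contra hc
            exact hi.2 (h i hi.1 hc)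
      omega
    have h1' : (#S : ℝ) ≤ #(S.filter (fun i => w i = 0)) + ∑ i ∈ S', (w i : ℝ) := by exact_mod_cast h1
    linarith
  have hZ := zeros wb D D (fun i h1 h2 => absurd h1 h2)
  set Z := D.filter (fun i => wb i = 0) with hZdef
  have hZ4 : t / 4 ≤ #Z := by nlinarith
  obtain ⟨z, hzZ, hzbad⟩ := bad_avg Γr Γb Z (by
    rw [← Finset.card_pos]
    have : (0:ℝ) < #Z := by linarith
    exact_mod_cast this)
  have hzbad' : (#{y | ¬ Γr.Adj z y ∧ ¬ Γb.Adj z y} : ℝ) ≤ 4 * κ^2 * t := by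
    have h0 : (0:ℝ) ≤ #{y | ¬ Γr.Adj z y ∧ ¬ Γb.Adj z y} := by positivity
    by_contra hcon
    push Not at hcon
    have : t / 4 * (4 * κ^2 * t) < (#Z : ℝ) * #{y | ¬ Γr.Adj z y ∧ ¬ Γb.Adj z y} := by
      apply mul_lt_mul' hZ4 hcon (by positivity) (by linarith)
    nlinarith
  have Zb : ∀ x ∈ D, ∀ y ∈ Z, wb x < 2 → ¬ Γb.Adj x y := by
    intro x hx y hy hw hadj
    have := hwb x y ((memD x).1 hx) hadj
    simp only [hZdef, mem_filter] at hy
    omega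
  rcases comp_cover Γr ((2/3 + κ) * t) z with h | ⟨wr, hwr, hwrs⟩
  · exact Or.inl h
  set C := univ.filter (fun i => Γr.Reachable z i) with hCdef
  have memC : ∀ i, i ∈ C ↔ Γr.Reachable z i := by simp [hCdef]
  have Cadj : ∀ i j, i ∈ C → Γr.Adj i j → j ∈ C := by
    intro i j hi hij
    rw [memC] at hi ⊢
    exact hi.trans hij.reachable
  have hZD : Z ⊆ D := filter_subset _ _
  set Z' := Z.filter (fun i => i ∈ C) with hZ'def
  have hZ' : t / 5 ≤ #Z' := by
    have e1 := Finset.card_filter_add_card_filter_not (s := Z) (fun i => i ∈ C)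
    have e2 : #(Z.filter (fun i => ¬ i ∈ C)) ≤ #{y | ¬ Γr.Adj z y ∧ ¬ Γb.Adj z y} := by
      apply Finset.card_le_card
      intro y hy
      simp only [mem_filter, mem_univ, true_and] at hy ⊢
      refine ⟨fun h => hy.2 (Cadj z y ((memC z).2 (SimpleGraph.Reachable.refl z)) h), ?_⟩
      apply Zb z (hZD hzZ) y hy.1
      have := (mem_filter.1 hzZ).2
      omega
    have e1' : (#Z' : ℝ) + #(Z.filter (fun i => ¬ i ∈ C)) = #Z := by exact_mod_cast e1
    have e2' : (#(Z.filter (fun i => ¬ i ∈ C)) : ℝ) ≤ #{y | ¬ Γr.Adj z y ∧ ¬ Γb.Adj z y} := by exact_mod_cast e2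
    nlinarith
  set E := D.filter (fun i => i ∉ C ∧ wb i < 2) with hEdef
  have hE : (#E : ℝ) ≤ 5 * κ^2 * t := by
    have := bad_rect (Γr := Γr) (Γb := Γb) (X := E) (Y := Z') (by
      intro x hx y hy
      simp only [hEdef, hZ'def, mem_filter] at hx hy
      refine ⟨fun h => hx.2.1 (Cadj y x hy.2 h.symm), Zb x hx.1 y hy.1 hx.2.2⟩)
    by_contra hcon
    push Not at hcon
    have : (5 * κ^2 * t) * (t / 5) < (#E : ℝ) * #Z' := 
      mul_lt_mul hcon hZ' (by positivity) (by positivity)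
    nlinarith
  set W := D \ E with hWdef
  have hW : (1 - 3 * κ) * t ≤ #W := by
    have e1 := Finset.card_sdiff_add_card_eq_card (filter_subset (fun i => i ∉ C ∧ wb i < 2) D)
    have e1' : (#W : ℝ) + #E = #D := by exact_mod_cast e1
    nlinarith
  have hWD : W ⊆ D := sdiff_subset
  have hWoff : ∀ i ∈ W, i ∉ C → 2 ≤ wb i := by
    intro i hi hiC
    simp only [hWdef, hEdef, mem_sdiff, mem_filter, not_and, not_lt] at hi
    exact hi.2 hi.1 hiC
  let wr' : ι → ℕ := fun i => if i ∈ C then wr i else 0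
  have hwr's : ∑ i ∈ C, (wr' i : ℝ) < (2/3 + κ) * t := by
    refine lt_of_eq_of_lt ?_ hwrs
    apply Finset.sum_congr rfl
    intro i hi
    simp only [wr', if_pos hi]
  have hredge : ∀ i j, i ∈ C → Γr.Adj i j → 2 ≤ wr' i + wr' j := by
    intro i j hi hij
    simp only [wr', if_pos hi, if_pos (Cadj i j hi hij)]
    exact hwr i j ((memC i).1 hi) hij
  have hbedge : ∀ i j, i ∈ D → Γb.Adj i j → 2 ≤ wb i + wb j := fun i j hi hij =>
    hwb i j ((memD i).1 hi) hij
  set P := W.filter (fun i => wr' i = 0 ∧ wb i = 0) with hP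
  set Q1 := W.filter (fun i => wr' i = 0 ∧ wb i = 1) with hQ1
  set Q2 := W.filter (fun i => wr' i = 1 ∧ wb i = 0) with hQ2
  have inC : ∀ i ∈ W, wb i < 2 → i ∈ C := by
    intro i hi h
    by_contra hc
    have := hWoff i hi hc
    omega
  have hPc : (#P : ℝ) ≤ κ * t := by
    have := bad_rect (Γr := Γr) (Γb := Γb) (X := P) (Y := P) (by
      intro x hx y hy
      simp only [hP, mem_filter] at hx hy
      constructor
      · intro h
        have := hredge x y (inC x hx.1 (by omega)) h
        omega
      · intro h
        have := hbedge x y (hWD hx.1) h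
        omega)
    have h2 : (#P : ℝ)^2 ≤ (κ * t)^2 := by nlinarith
    exact abs_le_of_sq_le_sq' h2 (by positivity) |>.2
  have hQ12 : (#Q1 : ℝ) * #Q2 ≤ κ^2 * t^2 := by
    refine le_trans (bad_rect (Γr := Γr) (Γb := Γb) ?_) hbad
    intro x hx y hy
    simp only [hQ1, hQ2, mem_filter] at hx hy
    constructor
    · intro h
      have := hredge x y (inC x hx.1 (by omega)) h
      omega
    · intro h
      have := hbedge x y (hWD hx.1) h
      omega
  have hsum : 2 * (#W : ℝ) ≤ 2 * #P + #Q1 + #Q2 + (∑ i ∈ C, (wr' i : ℝ) + ∑ i ∈ D, (wb i : ℝ)) := by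
    have h1 : 2 * #W ≤ 2 * #P + #Q1 + #Q2 + (∑ i ∈ W, wr' i + ∑ i ∈ W, wb i) := by
      have : ∀ i ∈ W, 2 ≤ 2 * (if (wr' i = 0 ∧ wb i = 0) then 1 else 0) + (if (wr' i = 0 ∧ wb i = 1) then 1 else 0)
        + (if (wr' i = 1 ∧ wb i = 0) then 1 else 0) + (wr' i + wb i) := by
        intro i _
        split_ifs <;> omega
      have := Finset.card_nsmul_le_sum W _ 2 this
      rw [sum_add_distrib, sum_add_distrib, sum_add_distrib, sum_add_distrib, ← Finset.mul_sum, ← Finset.card_filter,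
        ← Finset.card_filter, ← Finset.card_filter, smul_eq_mul] at this
      simp only [hP, hQ1, hQ2]
      linarith
    have h2 : ∑ i ∈ W, wr' i ≤ ∑ i ∈ C, wr' i := by
      have : ∑ i ∈ W, wr' i = ∑ i ∈ W.filter (fun i => i ∈ C), wr' i := by
        rw [Finset.sum_filter]
        apply Finset.sum_congr rfl
        intro i _
        simp only [wr']; split_ifs <;> rfl
      rw [this]
      apply Finset.sum_le_sum_of_subset
      intro i hi
      exact (mem_filter.1 hi).2
    have h3 : ∑ i ∈ W, wb i ≤ ∑ i ∈ D, wb i := Finset.sum_le_sum_of_subset hWD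
    have : 2 * #W ≤ 2 * #P + #Q1 + #Q2 + (∑ i ∈ C, wr' i + ∑ i ∈ D, wb i) := by omega
    exact_mod_cast this
  have hq : (2/3 - 10 * κ) * t ≤ #Q1 + #Q2 := by nlinarith
  by_cases hcase : (#Q2 : ℝ) ≤ κ * t
  · right; right; left
    have hB := zeros wb W D (fun i h1 h2 => absurd (hWD h1) h2)
    refine ⟨Q1, W.filter (fun i => wb i = 0), ?_, by nlinarith, by nlinarith, ?_, ?_⟩
    · rw [Finset.disjoint_left]
      intro x hx hx'
      simp only [hQ1, mem_filter] at hx hx'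
      omega
    · intro x hx y hy h
      simp only [hQ1, mem_filter] at hx hy
      have := hredge x y (inC x hx.1 (by omega)) h
      omega
    · intro x hx y hy h
      simp only [hQ1, mem_filter] at hx hy
      have := hbedge x y (hWD hx.1) h
      omega
  · right; right; right
    have hB := zeros wr' W C (fun i h1 h2 => by simp only [wr', if_neg h2])
    have hQ1s : (#Q1 : ℝ) ≤ κ * t := by
      push Not at hcase
      by_contra hc
      push Not at hc
      have : (κ * t) * (κ * t) < (#Q1 : ℝ) * #Q2 := 
        mul_lt_mul hc hcase.le (by positivity) (by positivity)
      nlinarith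
    refine ⟨Q2, W.filter (fun i => wr' i = 0), ?_, by nlinarith, by nlinarith, ?_, ?_⟩
    · rw [Finset.disjoint_left]
      intro x hx hx'
      simp only [hQ2, mem_filter] at hx hx'
      omega
    · intro x hx y hy h
      simp only [hQ2, mem_filter] at hx hy
      have := hbedge x y (hWD hx.1) h
      omega
    · intro x hx y hy h
      simp only [hQ2, mem_filter] at hx hy
      have := hredge x y (inC x hx.1 (by omega)) h
      omega

open Classical in
lemma badP_comm {ι : Type*} [Fintype ι] (Γr Γb : SimpleGraph ι) : badP Γr Γb = badP Γb Γr := by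
  unfold badP
  congr 1
  ext p
  exact and_comm

lemma stability {ι : Type*} [Fintype ι] (Γr Γb : SimpleGraph ι) (κ : ℝ) (ht : 0 < Fintype.card ι)
    (hκ : 0 < κ) (hκ1 : κ ≤ 1/1000) 
    (hbad : (#(badP Γr Γb) : ℝ) ≤ κ^2 * (Fintype.card ι : ℝ)^2) :
    LongM Γr ((2/3 + κ) * (Fintype.card ι : ℝ)) ∨ LongM Γb ((2/3 + κ) * (Fintype.card ι : ℝ)) ∨
    ExtS Γr Γb ((2/3 - 11 * κ) * (Fintype.card ι : ℝ)) ((1/3 - 4 * κ) * (Fintype.card ι : ℝ)) ∨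
    ExtS Γb Γr ((2/3 - 11 * κ) * (Fintype.card ι : ℝ)) ((1/3 - 4 * κ) * (Fintype.card ι : ℝ)) := by
  classical
  have ht' : (0:ℝ) < Fintype.card ι := by exact_mod_cast ht
  have hne : (univ : Finset ι).Nonempty := by
    rw [← Finset.card_pos]; simpa using ht
  obtain ⟨i0, -, hi0⟩ := bad_avg Γr Γb univ hne
  rw [Finset.card_univ] at hi0
  set t : ℝ := (Fintype.card ι : ℝ) with htdef
  have hi0' : (#{y | ¬ Γr.Adj i0 y ∧ ¬ Γb.Adj i0 y} : ℝ) ≤ κ^2 * t := by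
    have : t * (#{y | ¬ Γr.Adj i0 y ∧ ¬ Γb.Adj i0 y} : ℝ) ≤ t * (κ^2 * t) := by
      refine hi0.trans (hbad.trans ?_); nlinarith
    exact le_of_mul_le_mul_left this ht'
  set C := univ.filter (fun i => Γr.Reachable i0 i) with hC
  set D := univ.filter (fun i => Γb.Reachable i0 i) with hD
  have Cadj : ∀ i j, i ∈ C → Γr.Adj i j → j ∈ C := by
    intro i j hi hij
    simp only [hC, mem_filter, mem_univ, true_and] at hi ⊢
    exact hi.trans hij.reachable
  have Dadj : ∀ i j, i ∈ D → Γb.Adj i j → j ∈ D := by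
    intro i j hi hij
    simp only [hD, mem_filter, mem_univ, true_and] at hi ⊢
    exact hi.trans hij.reachable
  have i0C : i0 ∈ C := by simp [hC]
  have i0D : i0 ∈ D := by simp [hD]
  have hun : t ≤ #(C ∪ D) + κ^2 * t := by
    have : (univ : Finset ι) ⊆ (C ∪ D) ∪ univ.filter (fun y => ¬ Γr.Adj i0 y ∧ ¬ Γb.Adj i0 y) := by
      intro y _
      simp only [mem_union, mem_filter, mem_univ, true_and]
      by_cases h1 : Γr.Adj i0 y
      · exact Or.inl (Or.inl (Cadj _ _ i0C h1))
      · by_cases h2 : Γb.Adj i0 y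
        · exact Or.inl (Or.inr (Dadj _ _ i0D h2))
        · exact Or.inr ⟨h1, h2⟩
    have := (Finset.card_le_card this).trans (Finset.card_union_le _ _)
    rw [Finset.card_univ] at this
    have : t ≤ #(C ∪ D) + (#{y | ¬ Γr.Adj i0 y ∧ ¬ Γb.Adj i0 y} : ℝ) := by
      rw [htdef]; exact_mod_cast this
    linarith
  have hrect : (#(D \ C) : ℝ) * #(C \ D) ≤ κ^2 * t^2 := by
    refine le_trans (bad_rect (Γr := Γr) (Γb := Γb) ?_) hbad
    intro x hx y hy
    rw [mem_sdiff] at hx hy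
    exact ⟨fun h => hx.2 (Cadj _ _ hy.1 h.symm), fun h => hy.2 (Dadj _ _ hx.1 h)⟩
  have u1 : (#(C ∪ D) : ℝ) = #D + #(C \ D) := by
    have := Finset.card_sdiff_add_card C D
    have : #(C ∪ D) = #D + #(C \ D) := by omega
    exact_mod_cast this
  have u2 : (#(C ∪ D) : ℝ) = #C + #(D \ C) := by
    have := Finset.card_sdiff_add_card D C
    rw [Finset.union_comm] at this
    have : #(C ∪ D) = #C + #(D \ C) := by omega
    exact_mod_cast this
  by_cases hcase : (#(C \ D) : ℝ) ≤ κ * t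
  · exact stab_half Γr Γb κ t ht' hκ hκ1 hbad i0 (by rw [← hD]; nlinarith)
  · have hs : (#(D \ C) : ℝ) ≤ κ * t := by
      push Not at hcase
      by_contra hc
      push Not at hc
      have : (κ * t) * (κ * t) < (#(D \ C) : ℝ) * #(C \ D) := 
        mul_lt_mul hc hcase.le (by positivity) (by positivity)
      nlinarith
    have := stab_half Γb Γr κ t ht' hκ hκ1 (by rw [badP_comm]; exact hbad) i0 (by rw [← hC]; nlinarith)
    tauto

lemma sigma_count {α β γ : Type*} (F : Finset α) (F' : Finset β) (E : α → Finset γ) (φ : α → γ → β)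
    (hmap : ∀ a ∈ F, ∀ x ∈ E a, φ a x ∈ F')
    (hinj : ∀ a ∈ F, ∀ x ∈ E a, ∀ a' ∈ F, ∀ x' ∈ E a', φ a x = φ a' x' → a = a' ∧ x = x')
    (m : ℝ) (hm : ∀ a ∈ F, m ≤ #(E a)) : (#F : ℝ) * m ≤ #F' := by
  have h1 : #(F.sigma E) ≤ #F' := by
    apply Finset.card_le_card_of_injOn (fun p => φ p.1 p.2)
    · rintro ⟨a, x⟩ h
      simp only [coe_sigma, Set.mem_sigma_iff, mem_coe] at h
      exact hmap a h.1 x h.2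
    · rintro ⟨a, x⟩ h ⟨a', x'⟩ h' e
      simp only [coe_sigma, Set.mem_sigma_iff, mem_coe] at h h'
      obtain ⟨rfl, rfl⟩ := hinj a h.1 x h.2 a' h'.1 x' h'.2 e
      rfl
  calc (#F : ℝ) * m = ∑ a ∈ F, m := by simp
    _ ≤ ∑ a ∈ F, (#(E a) : ℝ) := Finset.sum_le_sum hm
    _ = (#(F.sigma E) : ℝ) := by rw [Finset.card_sigma]; push_cast; rfl
    _ ≤ _ := by exact_mod_cast h1

lemma factorial_lower (k : ℕ) : ((k : ℝ) / 3) ^ k ≤ (k.factorial : ℝ) := by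
  have h1 := Real.pow_div_factorial_le_exp (k : ℝ) (by positivity) k
  have h2 : Real.exp k ≤ 3 ^ k := by
    have : Real.exp k = Real.exp 1 ^ k := by rw [← Real.exp_nat_mul]; simp
    rw [this]
    exact pow_le_pow_left₀ (Real.exp_pos 1).le (by linarith [Real.exp_one_lt_d9]) k
  have hf : (0:ℝ) < k.factorial := by exact_mod_cast Nat.factorial_pos k
  rw [div_pow, div_le_iff₀ (by positivity)]
  rw [div_le_iff₀ hf] at h1
  nlinarith

open Classical in
lemma dense_paths {V : Type*} [Fintype V] (G : SimpleGraph V) (K : Finset V) (k : ℕ) (hK : #K = k)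
    (h8 : 8 ≤ k) (hdeg : ∀ v ∈ K, 10 * #{u ∈ K | ¬ G.Adj v u} ≤ k) :
    ((k : ℝ) / 12) ^ k ≤ ((PL G k).ncard : ℝ) := by
  have fin : ∀ j, ({l | l.length = j ∧ l.Nodup ∧ l.IsChain G.Adj ∧ ∀ x ∈ l, x ∈ K} : Set (List V)).Finite :=
    fun j => (List.finite_length_eq V j).subset (fun _ h => h.1)
  let Ω : ℕ → Finset (List V) := fun j => (fin j).toFinset
  have memΩ : ∀ j l, l ∈ Ω j ↔ l.length = j ∧ l.Nodup ∧ l.IsChain G.Adj ∧ ∀ x ∈ l, x ∈ K := by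
    intro j l; simp [Ω]
  have hcompl : ∀ l : List V, l.Nodup → (∀ x ∈ l, x ∈ K) → #{x ∈ K | x ∉ l} = k - l.length := by
    intro l h1 h2
    have : {x ∈ K | x ∉ l} = K \ l.toFinset := by ext x; simp
    rw [this, Finset.card_sdiff_of_subset (by intro x; simp; exact h2 x), List.toFinset_card_of_nodup h1, hK]
  have step : ∀ j < k, (#(Ω j) : ℝ) * (((k:ℝ) - j) / 4) ≤ #(Ω (j+1)) := by
    intro j hj
    by_cases hj2 : 2 * j ≤ k
    · apply sigma_count (Ω j) (Ω (j+1)) (fun l => {x ∈ K | x ∉ l ∧ ∀ h ∈ l.head?, G.Adj h x}) (fun l x => x :: l)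
      · intro l hl x hx
        rw [memΩ] at hl ⊢
        simp only [mem_filter] at hx
        refine ⟨by simp [hl.1], List.nodup_cons.2 ⟨hx.2.1, hl.2.1⟩,
          List.isChain_cons.2 ⟨fun y hy => (hx.2.2 y hy).symm, hl.2.2.1⟩, ?_⟩
        intro y hy
        rcases List.mem_cons.1 hy with rfl | hy
        · exact hx.1
        · exact hl.2.2.2 y hy
      · intro l _ x _ l' _ x' _ e
        simp at e
        exact ⟨e.2, e.1⟩
      · intro l hl
        rw [memΩ] at hl
        have e1 := hcompl l hl.2.1 hl.2.2.2
        have e2 : 10 * #{x ∈ K | ∃ h ∈ l.head?, ¬ G.Adj h x} ≤ k := by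
          cases l with
          | nil => simp
          | cons a l =>
            have := hdeg a (hl.2.2.2 a (by simp))
            simpa using this
        have e3 : #{x ∈ K | x ∉ l} ≤ #{x ∈ K | x ∉ l ∧ ∀ h ∈ l.head?, G.Adj h x} +
            #{x ∈ K | ∃ h ∈ l.head?, ¬ G.Adj h x} := by
          refine le_trans (Finset.card_le_card ?_) (Finset.card_union_le _ _)
          intro x hx
          simp only [mem_filter, mem_union] at hx ⊢
          by_cases h : ∀ h ∈ l.head?, G.Adj h x
          · exact Or.inl ⟨hx.1, hx.2, h⟩
          · push Not at h
            exact Or.inr ⟨hx.1, h⟩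
        rw [e1, hl.1] at e3
        have e4 : k ≤ #{x ∈ K | x ∉ l ∧ ∀ h ∈ l.head?, G.Adj h x} + #{x ∈ K | ∃ h ∈ l.head?, ¬ G.Adj h x} + j := by omega
        have e4' : (k:ℝ) ≤ (#{x ∈ K | x ∉ l ∧ ∀ h ∈ l.head?, G.Adj h x} : ℝ) + #{x ∈ K | ∃ h ∈ l.head?, ¬ G.Adj h x} + j := by exact_mod_cast e4
        have e2' : 10 * (#{x ∈ K | ∃ h ∈ l.head?, ¬ G.Adj h x} : ℝ) ≤ k := by exact_mod_cast e2
        have e5 : 2 * (j:ℝ) ≤ k := by exact_mod_cast hj2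
        linarith
    · push Not at hj2
      have hj4 : 4 ≤ j := by omega
      have main := sigma_count (Ω j) (Ω (j+1) ×ˢ range (j-1))
        (fun l => ({x ∈ K | x ∉ l} ×ˢ range (j-1)).filter (fun q => ∀ u, (l[q.2]? = some u ∨ l[q.2+1]? = some u) → G.Adj u q.1))
        (fun l q => (l.take (q.2+1) ++ q.1 :: l.drop (q.2+1), q.2)) ?_ ?_ (((k:ℝ) - j) * ((j + 1) / 4)) ?_
      · rw [Finset.card_product, card_range] at main
        push_cast at main
        have hj1 : ((j - 1 : ℕ) : ℝ) ≤ j + 1 := by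
          have : j - 1 ≤ j + 1 := by omega
          exact_mod_cast this
        have hp : (0:ℝ) < (j:ℝ) + 1 := by positivity
        have : (#(Ω j) : ℝ) * (((k:ℝ) - j) / 4) * (j+1) ≤ #(Ω (j+1)) * (j+1) := by
          have h0 : (0:ℝ) ≤ #(Ω (j+1)) := by positivity
          nlinarith
        exact le_of_mul_le_mul_right this hp
      · rintro l hl ⟨v, p⟩ hq
        rw [memΩ] at hl
        simp only [mem_filter, mem_product, mem_range] at hq
        obtain ⟨⟨⟨hv, hvl⟩, hp⟩, hadj⟩ := hq
        rw [mem_product, memΩ, mem_range]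
        refine ⟨?_, hp⟩
        dsimp only
        have hpl : p + 1 < l.length := by omega
        have hcnt : ∀ x, (l.take (p+1) ++ v :: l.drop (p+1)).count x = l.count x + (if v = x then 1 else 0) := by
          intro x
          have h0 : l.count x = (l.take (p+1)).count x + (l.drop (p+1)).count x := by
            rw [← List.count_append, List.take_append_drop]
          rw [h0]
          simp [List.count_append, List.count_cons]; omega
        refine ⟨?_, ?_, ?_, ?_⟩
        · simp; omega
        · rw [List.nodup_iff_count_le_one]
          intro x
          rw [hcnt]
          split_ifs with h
          · subst h; rw [List.count_eq_zero.2 hvl]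
          · simpa using List.nodup_iff_count_le_one.1 hl.2.1 x
        · have hc := hl.2.2.1
          rw [List.isChain_append, List.isChain_cons]
          refine ⟨hc.take _, ⟨?_, hc.drop _⟩, ?_⟩
          · intro y hy
            rw [List.head?_drop] at hy
            exact (hadj y (Or.inr hy)).symm
          · intro x hx y hy
            simp at hy
            subst hy
            apply hadj x
            left
            rw [List.getLast?_take] at hx
            simp at hx
            rw [List.getElem?_eq_getElem (by omega)] at hx ⊢
            have hnl : ¬ l.length ≤ p := by omega
            simpa [hnl] using hx
        · intro x hx
          rcases List.mem_append.1 hx with h | h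
          · exact hl.2.2.2 x (List.mem_of_mem_take h)
          · rcases List.mem_cons.1 h with rfl | h
            · exact hv
            · exact hl.2.2.2 x (List.mem_of_mem_drop h)
      · rintro l hl ⟨v, p⟩ hq l' hl' ⟨v', p'⟩ hq' e
        rw [memΩ] at hl hl'
        simp only [Prod.mk.injEq] at e
        obtain ⟨e, rfl⟩ := e
        have := List.append_inj e (by simp [hl.1, hl'.1])
        obtain ⟨a1, a2⟩ := this
        simp only [List.cons.injEq] at a2
        refine ⟨?_, by simp [a2.1]⟩
        rw [← List.take_append_drop (p+1) l, a1, a2.2, List.take_append_drop]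
      · intro l hl
        rw [memΩ] at hl
        obtain ⟨hl1, hl2, hl3, hl4⟩ := hl
        have e1 := hcompl l hl2 hl4
        -- for each v
        have hv : ∀ v ∈ ({x ∈ K | x ∉ l} : Finset V), ((j + 1) / 4 : ℝ) ≤
            #{p ∈ range (j-1) | ∀ u, (l[p]? = some u ∨ l[p+1]? = some u) → G.Adj u v} := by
          intro v hv
          have hvK : v ∈ K := (mem_filter.1 hv).1
          have hd := hdeg v hvK
          have b : ∀ s, s ≤ 1 → #{p ∈ range (j-1) | ∃ u, l[p+s]? = some u ∧ ¬ G.Adj u v} ≤ #{u ∈ K | ¬ G.Adj v u} := by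
            intro s hs
            apply Finset.card_le_card_of_injOn (fun p => l.getD (p+s) v)
            · intro p hp
              simp only [coe_filter, mem_range, Set.mem_setOf_eq] at hp
              obtain ⟨hp, u, hu, hadj⟩ := hp
              simp only [coe_filter, Set.mem_setOf_eq, List.getD_eq_getElem?_getD, hu, Option.getD_some]
              exact ⟨hl4 u (List.mem_of_getElem? hu), fun h => hadj h.symm⟩
            · intro p hp p' hp' e
              simp only [coe_filter, mem_range, Set.mem_setOf_eq] at hp hp'
              have q1 : p + s < l.length := by omega
              have q2 : p' + s < l.length := by omega
              simp only [List.getD_eq_getElem?_getD, List.getElem?_eq_getElem q1, List.getElem?_eq_getElem q2, Option.getD_some] at e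
              have := (List.Nodup.getElem_inj_iff hl2).1 e
              omega
          have b0 := b 0 (by omega)
          have b1 := b 1 (by omega)
          have c1 : #(range (j-1)) ≤ #{p ∈ range (j-1) | ∀ u, (l[p]? = some u ∨ l[p+1]? = some u) → G.Adj u v} +
              (#{p ∈ range (j-1) | ∃ u, l[p+0]? = some u ∧ ¬ G.Adj u v} + #{p ∈ range (j-1) | ∃ u, l[p+1]? = some u ∧ ¬ G.Adj u v}) := by
            refine le_trans (Finset.card_le_card ?_) ((Finset.card_union_le _ _).trans
              (Nat.add_le_add_left (Finset.card_union_le _ _) _))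
            intro p hp
            simp only [mem_union, mem_filter, hp, true_and, add_zero]
            by_contra hcon
            push Not at hcon
            obtain ⟨⟨u, hu, hn⟩, h2, h3⟩ := hcon
            rcases hu with hu | hu
            · exact hn (h2 u hu)
            · exact hn (h3 u hu)
          rw [card_range] at c1
          have c2 : 10 * j ≤ 10 * #{p ∈ range (j-1) | ∀ u, (l[p]? = some u ∨ l[p+1]? = some u) → G.Adj u v} + 10 + 2 * k := by omega
          have c2' : 10 * (j:ℝ) ≤ 10 * (#{p ∈ range (j-1) | ∀ u, (l[p]? = some u ∨ l[p+1]? = some u) → G.Adj u v} : ℝ) + 10 + 2 * k := by exact_mod_cast c2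
          have c3 : (k:ℝ) + 1 ≤ 2 * j := by exact_mod_cast hj2
          have c4 : (4:ℝ) ≤ j := by exact_mod_cast hj4
          linarith
        have hcard : #((({x ∈ K | x ∉ l} : Finset V) ×ˢ range (j-1)).filter (fun q : V × ℕ => ∀ u, (l[q.2]? = some u ∨ l[q.2+1]? = some u) → G.Adj u q.1))
            = ∑ v ∈ ({x ∈ K | x ∉ l} : Finset V), #{p ∈ range (j-1) | ∀ u, (l[p]? = some u ∨ l[p+1]? = some u) → G.Adj u v} := by
          rw [Finset.card_filter, Finset.sum_product]
          apply Finset.sum_congr rfl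
          intro v _
          rw [Finset.card_filter]
        rw [hcard]
        push_cast
        have := Finset.card_nsmul_le_sum _ _ _ hv
        rw [e1, hl1, nsmul_eq_mul, Nat.cast_sub hj.le] at this
        exact this
  have prod : ∀ j ≤ k, ∏ i ∈ range j, (((k:ℝ) - i) / 4) ≤ #(Ω j) := by
    intro j
    induction j with
    | zero =>
      intro _
      have : [] ∈ Ω 0 := by rw [memΩ]; simp
      have : 1 ≤ #(Ω 0) := Finset.card_pos.2 ⟨_, this⟩
      simpa using this
    | succ j ih =>
      intro hj
      rw [prod_range_succ]
      refine le_trans ?_ (step j (by omega))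
      apply mul_le_mul_of_nonneg_right (ih (by omega))
      have : (j:ℝ) ≤ k := by exact_mod_cast (by omega : j ≤ k)
      linarith
  have hfin := prod k le_rfl
  have hprod : ∏ i ∈ range k, (((k:ℝ) - i) / 4) = k.factorial / 4 ^ k := by
    rw [Finset.prod_div_distrib, prod_const, card_range]
    congr 1
    rw [← Finset.prod_range_add_one_eq_factorial, ← Finset.prod_range_reflect]
    push_cast
    apply Finset.prod_congr rfl
    intro i hi
    rw [mem_range] at hi
    have : ((k - 1 - i : ℕ) : ℝ) = k - 1 - i := by
      rw [Nat.cast_sub (by omega), Nat.cast_sub (by omega)]; simp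
    rw [this]; ring
  rw [hprod] at hfin
  have hsub : #(Ω k) ≤ (PL G k).ncard := by
    rw [← Set.ncard_coe_finset]
    apply Set.ncard_le_ncard _ (PL_finite G k)
    intro l hl
    have := (memΩ k l).1 hl
    exact ⟨this.1, this.2.1, this.2.2.1⟩
  have hsub' : (#(Ω k) : ℝ) ≤ ((PL G k).ncard : ℝ) := by exact_mod_cast hsub
  refine le_trans ?_ (hfin.trans hsub')
  have := factorial_lower k
  have e : ((k:ℝ)/12)^k = ((k:ℝ)/3)^k / 4^k := by rw [← div_pow]; congr 1; ring
  rw [e]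
  gcongr

open Classical in
/-- Invariant for alternating paths, encoded as lists of pairs. -/
def AInv {V : Type*} (H : SimpleGraph V) (A0 B1 E1 : Finset V) (z : ℕ) : List (V × V) → Prop
  | [] => True
  | p :: l => AInv H A0 B1 E1 z l ∧ p.1 ∈ B1 ∧ p.1 ∉ l.map Prod.fst ∧
      (p.1 ∈ E1 ↔ (l.length % 2 = 0 ∧ l.length < 2 * z)) ∧ p.2 ∈ A0 ∧ p.2 ∉ l.map Prod.snd ∧
      H.Adj p.1 p.2 ∧ ∀ p' ∈ l.head?, H.Adj p.2 p'.1

/-- flatten a list of pairs -/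
def flatP {V : Type*} (l : List (V × V)) : List V := l.flatMap (fun p => [p.1, p.2])

lemma flatP_inj {V : Type*} : ∀ (l l' : List (V × V)), flatP l = flatP l' → l = l'
  | [], [], _ => rfl
  | [], p :: l', h => by simp [flatP] at h
  | p :: l, [], h => by simp [flatP] at h
  | p :: l, p' :: l', h => by
    simp only [flatP, List.flatMap_cons, List.cons_append, List.nil_append, List.cons.injEq] at h
    obtain ⟨h1, h2, h3⟩ := h
    rw [flatP_inj l l' h3, Prod.ext h1 h2]

lemma flatP_mem {V : Type*} (l : List (V × V)) (x : V) :
    x ∈ flatP l ↔ x ∈ l.map Prod.fst ∨ x ∈ l.map Prod.snd := by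
  induction l with
  | nil => simp [flatP]
  | cons p l ih =>
    have : flatP (p :: l) = p.1 :: p.2 :: flatP l := by simp [flatP]
    rw [this]; simp only [List.mem_cons, List.map_cons, ih]; tauto

lemma AInv_props {V : Type*} {H : SimpleGraph V} {A0 B1 E1 : Finset V} {z : ℕ}
    (hdis : Disjoint A0 B1) (l : List (V × V)) (h : AInv H A0 B1 E1 z l) :
    (∀ x ∈ l.map Prod.fst, x ∈ B1) ∧ (∀ x ∈ l.map Prod.snd, x ∈ A0) ∧
    (flatP l).length = 2 * l.length ∧ (flatP l).Nodup ∧ (flatP l).IsChain H.Adj ∧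
    (flatP l).head? = l.head?.map Prod.fst := by
  induction l with
  | nil => simp [flatP]
  | cons p l ih =>
    obtain ⟨h0, h1, h2, h3, h4, h5, h6, h7⟩ := h
    obtain ⟨i1, i2, i3, i4, i5, i6⟩ := ih h0
    have e : flatP (p :: l) = p.1 :: p.2 :: flatP l := by simp [flatP]
    have hd := Finset.disjoint_left.1 hdis
    refine ⟨?_, ?_, ?_, ?_, ?_, ?_⟩
    · intro x hx
      rw [List.map_cons] at hx
      rcases List.mem_cons.1 hx with rfl | hx
      · exact h1
      · exact i1 x hx
    · intro x hx
      rw [List.map_cons] at hx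
      rcases List.mem_cons.1 hx with rfl | hx
      · exact h4
      · exact i2 x hx
    · rw [e]; simp [i3]; ring
    · rw [e, List.nodup_cons, List.nodup_cons, List.mem_cons, flatP_mem, flatP_mem]
      refine ⟨?_, ?_, i4⟩
      · rintro (h | h | h)
        · exact h6.ne h
        · exact h2 h
        · exact hd (i2 _ h) h1
      · rintro (h | h)
        · exact hd h4 (i1 _ h)
        · exact h5 h
    · rw [e, List.isChain_cons_cons, List.isChain_cons]
      refine ⟨h6, ?_, i5⟩
      intro y hy
      rw [i6] at hy
      simp only [Option.mem_def, Option.map_eq_some_iff] at hy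
      obtain ⟨p', hp', rfl⟩ := hy
      exact h7 p' hp'
    · rw [e]; simp

open Classical in
lemma AInv_count {V : Type*} {H : SimpleGraph V} {A0 B1 E1 : Finset V} {z : ℕ}
    (l : List (V × V)) (h : AInv H A0 B1 E1 z l) :
    (l.map Prod.fst).countP (fun x => decide (x ∈ E1)) = min ((l.length + 1) / 2) z := by
  induction l with
  | nil => simp
  | cons p l ih =>
    obtain ⟨h0, h1, h2, h3, -⟩ := h
    rw [List.map_cons, List.countP_cons, ih h0, List.length_cons]
    by_cases hp : p.1 ∈ E1
    · have := h3.1 hp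
      simp [hp]; omega
    · have : ¬ (l.length % 2 = 0 ∧ l.length < 2 * z) := fun h => hp (h3.2 h)
      simp [hp]; omega

open Classical in
lemma unused_card {V : Type*} (S : Finset V) (L : List V) (n : ℕ)
    (h : L.countP (fun x => decide (x ∈ S)) ≤ n) : #S ≤ #{x ∈ S | x ∉ L} + n := by
  have e1 := Finset.card_filter_add_card_filter_not (s := S) (fun x => x ∈ L)
  have e2 : #{x ∈ S | x ∈ L} ≤ n := by
    refine le_trans ?_ h
    rw [List.countP_eq_length_filter]
    refine le_trans (Finset.card_le_card ?_) (List.toFinset_card_le _)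
    intro x hx
    simp at hx ⊢; tauto
  omega

/-- choices of the `B`-vertex at step `i` -/
def cB (r z i : ℕ) : ℕ := if i % 2 = 0 ∧ i < 2 * z then z - min ((i+1)/2) z
  else r - z - (i - min ((i+1)/2) z)

lemma cB_prod (r z : ℕ) (h : 2 * z ≤ r) : ∏ i ∈ range r, cB r z i = z.factorial * (r - z).factorial := by
  have : ∀ i ≤ r, (∏ j ∈ range i, cB r z j) * ((z - min ((i+1)/2) z).factorial *
      (r - z - (i - min ((i+1)/2) z)).factorial) = z.factorial * (r - z).factorial := by
    intro i
    induction i with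
    | zero => intro _; simp
    | succ i ih =>
      intro hi
      rw [← ih (by omega), prod_range_succ, mul_assoc]
      congr 1
      by_cases hc : i % 2 = 0 ∧ i < 2 * z
      · have e1 : cB r z i = z - min ((i+1)/2) z := by rw [cB, if_pos hc]
        have e2 : z - min ((i+1)/2) z = (z - min ((i+1+1)/2) z) + 1 := by omega
        have e3 : (i + 1 - min ((i+1+1)/2) z) = i - min ((i+1)/2) z := by omega
        rw [e1, e2, e3, Nat.factorial_succ]
        ring
      · have e1 : cB r z i = r - z - (i - min ((i+1)/2) z) := by rw [cB, if_neg hc]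
        have e2 : min ((i+1+1)/2) z = min ((i+1)/2) z := by omega
        have e3 : r - z - (i - min ((i+1)/2) z) = (r - z - (i + 1 - min ((i+1)/2) z)) + 1 := by omega
        rw [e1, e2, e3, Nat.factorial_succ]
        ring
  have h1 := this r le_rfl
  have e1 : z - min ((r+1)/2) z = 0 := by omega
  have e2 : r - z - (r - min ((r+1)/2) z) = 0 := by omega
  rw [e1, e2] at h1
  simpa using h1

lemma fact_split (r z : ℕ) (h : z ≤ r) : ((r : ℝ) / 6) ^ r ≤ (z.factorial : ℝ) * (r - z).factorial := by
  have h1 := Nat.choose_mul_factorial_mul_factorial h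
  have h2 : r.choose z ≤ 2 ^ r := Nat.choose_le_two_pow r z
  have h3 := factorial_lower r
  have h1' : (r.choose z : ℝ) * (z.factorial * (r - z).factorial) = r.factorial := by
    rw [← mul_assoc]; exact_mod_cast h1
  have h2' : (r.choose z : ℝ) ≤ 2 ^ r := by exact_mod_cast h2
  have h4 : (r.factorial : ℝ) ≤ 2 ^ r * (z.factorial * (r - z).factorial) := by
    rw [← h1']
    exact mul_le_mul_of_nonneg_right h2' (by positivity)
  have e : ((r:ℝ)/6)^r = ((r:ℝ)/3)^r / 2^r := by rw [← div_pow]; congr 1; ring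
  rw [e, div_le_iff₀ (by positivity)]
  linarith

set_option maxHeartbeats 1000000 in
open Classical in
lemma alt_paths {V : Type*} [Fintype V] (H : SimpleGraph V) (A0 B1 E1 : Finset V) (k z : ℕ)
    (hE : E1 ⊆ B1) (hdis : Disjoint A0 B1) (hB : #B1 = k / 2) (hz : #E1 = z) (hzk : 250 * z ≤ k)
    (hA : 9 * k ≤ 10 * #A0) (hk : 8 ≤ k)
    (htyp : ∀ b ∈ B1, b ∉ E1 → 1000 * #{a ∈ A0 | ¬ H.Adj b a} ≤ k)
    (hexc : ∀ b ∈ E1, k ≤ 20 * #{a ∈ A0 | H.Adj b a}) :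
    ((k : ℝ) / 40) ^ k ≤ ((PL H k).ncard : ℝ) := by
  set r := k / 2 with hr
  have hk0 : (0:ℝ) < k := by exact_mod_cast (by omega : 0 < k)
  have key := tree_cons (AInv H A0 B1 E1 z) (fun i => (cB r z i : ℝ) * ((k:ℝ)/40)) (fun i => by positivity)
    trivial r (by
      intro l hl hlr
      rw [Set.ncard_eq_toFinset_card']
      obtain ⟨p1, p2, -⟩ := AInv_props hdis l hl
      have hcnt := AInv_count l hl
      set exc : Prop := l.length % 2 = 0 ∧ l.length < 2 * z with hexcdef
      let S : Finset V := {b ∈ B1 | b ∉ l.map Prod.fst ∧ (b ∈ E1 ↔ exc)}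
      have hS : cB r z l.length ≤ #S := by
        by_cases hc : exc
        · have e1 : cB r z l.length = z - min ((l.length+1)/2) z := by rw [cB, if_pos hc]
          have := unused_card E1 (l.map Prod.fst) _ hcnt.le
          have h2 : #{x ∈ E1 | x ∉ l.map Prod.fst} ≤ #S := by
            apply Finset.card_le_card
            intro x hx
            simp only [mem_filter, S] at hx ⊢
            exact ⟨hE hx.1, hx.2, by simp [hx.1, hc]⟩
          omega
        · have e1 : cB r z l.length = r - z - (l.length - min ((l.length+1)/2) z) := by rw [cB, if_neg hc]
          have hco : (l.map Prod.fst).countP (fun x => decide (x ∈ B1 \ E1)) ≤ l.length - min ((l.length+1)/2) z := by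
            have h1 := List.length_eq_countP_add_countP (fun x => decide (x ∈ E1)) (l := l.map Prod.fst)
            rw [hcnt, List.length_map] at h1
            have h2 : (l.map Prod.fst).countP (fun x => decide (x ∈ B1 \ E1)) ≤
                (l.map Prod.fst).countP (fun x => decide (¬ (decide (x ∈ E1)) = true)) := by
              apply List.countP_mono_left
              intro x _ hx
              simp at hx ⊢; exact hx.2
            omega
          have := unused_card (B1 \ E1) (l.map Prod.fst) _ hco
          rw [Finset.card_sdiff_of_subset hE, hB, hz] at this
          have h2 : #{x ∈ B1 \ E1 | x ∉ l.map Prod.fst} ≤ #S := by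
            apply Finset.card_le_card
            intro x hx
            simp only [mem_filter, mem_sdiff, S] at hx ⊢
            exact ⟨hx.1.1, hx.2, by simp [hx.1.2, hc]⟩
          omega
      let f : V → Finset V := fun b => {a ∈ A0 | a ∉ l.map Prod.snd ∧ H.Adj b a ∧ ∀ p' ∈ l.head?, H.Adj a p'.1}
      have hf : ∀ b ∈ S, (k:ℝ)/40 ≤ #(f b) := by
        intro b hb
        simp only [S, mem_filter] at hb
        have hused : #{a ∈ A0 | a ∈ l.map Prod.snd} ≤ l.length := by
          refine le_trans (Finset.card_le_card ?_) ((List.toFinset_card_le (l.map Prod.snd)).trans (by simp))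
          intro x hx
          rw [mem_filter] at hx
          simpa using hx.2
        have hmain : k ≤ 40 * #(f b) := by
          -- info about previous b
          cases l with
          | nil =>
            have e0 : f b = {a ∈ A0 | H.Adj b a} := by
              ext a; simp [f]
            rw [e0]
            by_cases hbE : b ∈ E1
            · have := hexc b hbE; omega
            · have h1 := htyp b hb.1 hbE
              have h2 := Finset.card_filter_add_card_filter_not (s := A0) (fun a => H.Adj b a)
              omega
          | cons p' l' =>
            obtain ⟨q0, q1, q2, q3, q4, q5, q6, q7⟩ := hl
            have hfe : f b = {a ∈ A0 | a ∉ (p' :: l').map Prod.snd ∧ H.Adj b a ∧ H.Adj a p'.1} := by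
              ext a
              simp only [f, List.head?_cons, Option.mem_def, Option.some.injEq, forall_eq', mem_filter]
            rw [hfe]
            simp only [List.length_cons] at *
            by_cases hbE : b ∈ E1
            · have hx := (hb.2.2.1 hbE)
              simp only [hexcdef] at hx
              have hp' : p'.1 ∉ E1 := fun h => by have := q3.1 h; omega
              have h1 := hexc b hbE
              have h2 := htyp _ q1 hp'
              have h3 : #{a ∈ A0 | H.Adj b a} ≤ #{a ∈ A0 | a ∉ (p' :: l').map Prod.snd ∧ H.Adj b a ∧ H.Adj a p'.1}
                  + (#{a ∈ A0 | a ∈ (p' :: l').map Prod.snd} + #{a ∈ A0 | ¬ H.Adj p'.1 a}) := by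
                refine le_trans (Finset.card_le_card ?_) ((Finset.card_union_le _ _).trans
                  (Nat.add_le_add_left (Finset.card_union_le _ _) _))
                intro a ha
                simp only [mem_union, mem_filter, H.adj_comm p'.1 a] at ha ⊢
                tauto
              omega
            · have h1 := htyp b hb.1 hbE
              by_cases hp' : p'.1 ∈ E1
              · have hx := q3.1 hp'
                have h2 := hexc _ hp'
                have h3 : #{a ∈ A0 | H.Adj p'.1 a} ≤ #{a ∈ A0 | a ∉ (p' :: l').map Prod.snd ∧ H.Adj b a ∧ H.Adj a p'.1}
                    + (#{a ∈ A0 | a ∈ (p' :: l').map Prod.snd} + #{a ∈ A0 | ¬ H.Adj b a}) := by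
                  refine le_trans (Finset.card_le_card ?_) ((Finset.card_union_le _ _).trans
                    (Nat.add_le_add_left (Finset.card_union_le _ _) _))
                  intro a ha
                  simp only [mem_union, mem_filter, H.adj_comm p'.1 a] at ha ⊢
                  tauto
                omega
              · have h2 := htyp _ q1 hp'
                have h3 : #A0 ≤ (#{a ∈ A0 | a ∉ (p' :: l').map Prod.snd ∧ H.Adj b a ∧ H.Adj a p'.1}
                    + #{a ∈ A0 | ¬ H.Adj p'.1 a}) + (#{a ∈ A0 | a ∈ (p' :: l').map Prod.snd} + #{a ∈ A0 | ¬ H.Adj b a}) := by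
                  refine le_trans (Finset.card_le_card ?_) ((Finset.card_union_le _ _).trans
                    (Nat.add_le_add (Finset.card_union_le _ _) (Finset.card_union_le _ _)))
                  intro a ha
                  simp only [mem_union, mem_filter, H.adj_comm p'.1 a] at ha ⊢
                  tauto
                omega
        have : (k:ℝ) ≤ 40 * #(f b) := by exact_mod_cast hmain
        linarith
      have hcc := sigma_count S ({x | AInv H A0 B1 E1 z (x :: l)} : Set (V × V)).toFinset f Prod.mk (by
        intro b hb a ha
        simp only [S, f, mem_filter] at hb ha
        simp only [Set.mem_toFinset, Set.mem_ofPred_eq]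
        exact ⟨hl, hb.1, hb.2.1, hb.2.2, ha.1, ha.2.1, ha.2.2.1, ha.2.2.2⟩) (by
        intro a _ x _ a' _ x' _ e
        simpa using e) _ hf
      refine le_trans ?_ hcc
      apply mul_le_mul_of_nonneg_right _ (by positivity)
      exact_mod_cast hS)
  rw [Finset.prod_mul_distrib, ← Nat.cast_prod, cB_prod r z (by omega), prod_const, card_range] at key
  have hlow : ((k:ℝ)/40)^r * ((k:ℝ)/40)^r ≤ ((z.factorial * (r - z).factorial : ℕ) : ℝ) * ((k:ℝ)/40)^r := by
    apply mul_le_mul_of_nonneg_right _ (by positivity)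
    have h1 := fact_split r z (by omega)
    push_cast
    refine le_trans (pow_le_pow_left₀ (by positivity) ?_ r) h1
    have : k ≤ 3 * r := by omega
    have : (k:ℝ) ≤ 3 * r := by exact_mod_cast this
    linarith
  have fin : ({l | l.length = r ∧ AInv H A0 B1 E1 z l} : Set (List (V × V))).Finite :=
    (List.finite_length_eq (V × V) r).subset (fun _ h => h.1)
  rw [Set.ncard_eq_toFinset_card _ fin] at key
  have key2 := hlow.trans key
  rw [← pow_add] at key2
  rw [Set.ncard_eq_toFinset_card _ (PL_finite H k)]
  by_cases hpar : k % 2 = 0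
  · have e : k = r + r := by omega
    have h1 : #fin.toFinset ≤ #(PL_finite H k).toFinset := by
      apply Finset.card_le_card_of_injOn flatP
      · intro l hl
        simp only [Set.Finite.coe_toFinset, Set.mem_ofPred_eq] at hl ⊢
        obtain ⟨p1, p2, p3, p4, p5, p6⟩ := AInv_props hdis l hl.2
        exact ⟨by rw [p3, hl.1]; omega, p4, p5⟩
      · intro l _ l' _ h
        exact flatP_inj l l' h
    calc ((k:ℝ)/40)^k = ((k:ℝ)/40)^(r+r) := by rw [← e]
      _ ≤ _ := key2
      _ ≤ _ := by exact_mod_cast h1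
  · have e : k = r + r + 1 := by omega
    have h1 := sigma_count fin.toFinset (PL_finite H k).toFinset
      (fun l => {a ∈ A0 | a ∉ l.map Prod.snd ∧ ∀ p' ∈ l.head?, H.Adj a p'.1}) (fun l a => a :: flatP l)
      (by
        intro l hl a ha
        simp only [Set.Finite.mem_toFinset, Set.mem_ofPred_eq] at hl ⊢
        obtain ⟨p1, p2, p3, p4, p5, p6⟩ := AInv_props hdis l hl.2
        simp only [mem_filter] at ha
        refine ⟨by rw [List.length_cons, p3, hl.1]; omega, ?_, ?_⟩
        · rw [List.nodup_cons, flatP_mem]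
          refine ⟨?_, p4⟩
          rintro (h | h)
          · exact Finset.disjoint_left.1 hdis ha.1 (p1 a h)
          · exact ha.2.1 h
        · rw [List.isChain_cons]
          refine ⟨?_, p5⟩
          intro y hy
          rw [p6] at hy
          simp only [Option.mem_def, Option.map_eq_some_iff] at hy
          obtain ⟨p', hp', rfl⟩ := hy
          exact ha.2.2 p' hp')
      (by
        intro l _ a _ l' _ a' _ h
        simp only [List.cons.injEq] at h
        exact ⟨flatP_inj l l' h.2, h.1⟩) ((k:ℝ)/40) (by
        intro l hl
        simp only [Set.Finite.mem_toFinset, Set.mem_ofPred_eq] at hl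
        obtain ⟨hl1, hl2⟩ := hl
        have hused : #{a ∈ A0 | a ∈ l.map Prod.snd} ≤ l.length := by
          refine le_trans (Finset.card_le_card ?_) ((List.toFinset_card_le (l.map Prod.snd)).trans (by simp))
          intro x hx
          rw [mem_filter] at hx
          simpa using hx.2
        have hmain : k ≤ 40 * #{a ∈ A0 | a ∉ l.map Prod.snd ∧ ∀ p' ∈ l.head?, H.Adj a p'.1} := by
          cases l with
          | nil => simp at hl1; omega
          | cons p' l' =>
            obtain ⟨q0, q1, q2, q3, q4, q5, q6, q7⟩ := hl2
            have hfe : {a ∈ A0 | a ∉ (p' :: l').map Prod.snd ∧ ∀ p'' ∈ (p' :: l').head?, H.Adj a p''.1} =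
              {a ∈ A0 | a ∉ (p' :: l').map Prod.snd ∧ H.Adj a p'.1} := by
              ext a
              simp only [List.head?_cons, Option.mem_def, Option.some.injEq, forall_eq', mem_filter]
            rw [hfe]
            simp only [List.length_cons] at *
            have hp' : p'.1 ∉ E1 := fun h => by have := q3.1 h; omega
            have h2 := htyp _ q1 hp'
            have h3 : #A0 ≤ #{a ∈ A0 | a ∉ (p' :: l').map Prod.snd ∧ H.Adj a p'.1}
                + (#{a ∈ A0 | a ∈ (p' :: l').map Prod.snd} + #{a ∈ A0 | ¬ H.Adj p'.1 a}) := by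
              refine le_trans (Finset.card_le_card ?_) ((Finset.card_union_le _ _).trans
                (Nat.add_le_add_left (Finset.card_union_le _ _) _))
              intro a ha
              simp only [mem_union, mem_filter, H.adj_comm p'.1 a] at ha ⊢
              tauto
            omega
        have : (k:ℝ) ≤ 40 * #{a ∈ A0 | a ∉ l.map Prod.snd ∧ ∀ p' ∈ l.head?, H.Adj a p'.1} := by exact_mod_cast hmain
        linarith)
    calc ((k:ℝ)/40)^k = ((k:ℝ)/40)^(r+r) * ((k:ℝ)/40) := by rw [← pow_succ, ← e]
      _ ≤ #fin.toFinset * ((k:ℝ)/40) := mul_le_mul_of_nonneg_right key2 (by positivity)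
      _ ≤ _ := h1

lemma markov_nat {V : Type*} (S : Finset V) (f : V → ℕ) (k : ℕ) (hk : 0 < k)
    (h : 1000000 * ∑ x ∈ S, f x ≤ k * k) : 1000 * #{x ∈ S | ¬ 1000 * f x ≤ k} ≤ k := by
  have h1 : #{x ∈ S | ¬ 1000 * f x ≤ k} * k ≤ ∑ x ∈ {x ∈ S | ¬ 1000 * f x ≤ k}, 1000 * f x := by
    rw [← smul_eq_mul]
    apply Finset.card_nsmul_le_sum
    intro x hx
    simp only [mem_filter] at hx
    omega
  have h2 : ∑ x ∈ {x ∈ S | ¬ 1000 * f x ≤ k}, 1000 * f x ≤ ∑ x ∈ S, 1000 * f x :=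
    Finset.sum_le_sum_of_subset (filter_subset _ _)
  have h3 : ∑ x ∈ S, 1000 * f x = 1000 * ∑ x ∈ S, f x := (Finset.mul_sum _ _ _).symm
  have : (1000 * #{x ∈ S | ¬ 1000 * f x ≤ k}) * k ≤ k * k := by
    generalize #{x ∈ S | ¬ 1000 * f x ≤ k} = q at *
    have e : 1000 * q * k = 1000 * (q * k) := by ring
    omega
  exact Nat.le_of_mul_le_mul_right this hk

open Classical in
lemma extremal {V : Type*} [Fintype V] (G : SimpleGraph V) (k : ℕ) (hk : 8 ≤ k)
    (hV : Fintype.card V = k - 1 + k / 2) (A B : Finset V) (hAB : Disjoint A B)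
    (hA : 999 * k ≤ 1000 * #A) (hB : 499 * k ≤ 1000 * #B)
    (h1 : 1000000 * ∑ x ∈ A, #{y ∈ A | ¬ G.Adj x y} ≤ k * k)
    (h2 : 1000000 * ∑ x ∈ B, #{y ∈ A | G.Adj x y} ≤ k * k) :
    ((k : ℝ) / 40) ^ k ≤ ((PL G k).ncard : ℝ) ∨ ((k : ℝ) / 40) ^ k ≤ ((PL Gᶜ k).ncard : ℝ) := by
  have m1 := markov_nat A _ k (by omega) h1
  have m2 := markov_nat B _ k (by omega) h2
  have s1 := Finset.card_filter_add_card_filter_not (s := A) (fun x => 1000 * #{y ∈ A | ¬ G.Adj x y} ≤ k)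
  have s2 := Finset.card_filter_add_card_filter_not (s := B) (fun x => 1000 * #{y ∈ A | G.Adj x y} ≤ k)
  set A0 := {x ∈ A | 1000 * #{y ∈ A | ¬ G.Adj x y} ≤ k} with hA0
  set B0 := {x ∈ B | 1000 * #{y ∈ A | G.Adj x y} ≤ k} with hB0
  have hA0A : A0 ⊆ A := filter_subset _ _
  have hB0B : B0 ⊆ B := filter_subset _ _
  have hd0 : Disjoint A0 B0 := Finset.disjoint_of_subset_left hA0A (Finset.disjoint_of_subset_right hB0B hAB)
  set Z := univ \ (A0 ∪ B0) with hZ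
  have hZc : 250 * #Z ≤ k := by
    have : #Z + #(A0 ∪ B0) = #(univ : Finset V) := by
      rw [hZ]; convert Finset.card_sdiff_add_card_eq_card (subset_univ (A0 ∪ B0))
    rw [Finset.card_union_of_disjoint hd0, Finset.card_univ, hV] at this
    omega
  set Y := B0 ∪ {z ∈ Z | k ≤ 20 * #{a ∈ A0 | Gᶜ.Adj z a}} with hY
  have hYc := Finset.card_sdiff_add_card_eq_card (subset_univ Y)
  rw [Finset.card_univ, hV] at hYc
  by_cases hcase : k ≤ #(univ \ Y)
  · left
    obtain ⟨K, hK, hKc⟩ := Finset.exists_subset_card_eq hcase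
    have := dense_paths G K k hKc hk (by
      intro v hv
      have hv' := hK hv
      simp only [hY, mem_sdiff, mem_univ, true_and, mem_union, mem_filter, not_or, not_and, not_le] at hv'
      have hKZ : ∀ u ∈ K, u ∈ A0 ∨ u ∈ Z := by
        intro u hu
        have hu' := hK hu
        simp only [hY, mem_sdiff, mem_univ, true_and, mem_union, not_or] at hu'
        by_cases h : u ∈ A0
        · exact Or.inl h
        · right; simp [hZ, h, hu'.1]
      have hb : #{u ∈ K | ¬ G.Adj v u} ≤ #{u ∈ A0 | ¬ G.Adj v u} + #Z := by
        refine le_trans (Finset.card_le_card ?_) (Finset.card_union_le _ _)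
        intro u hu
        simp only [mem_filter, mem_union] at hu ⊢
        rcases hKZ u hu.1 with h | h
        · exact Or.inl ⟨h, hu.2⟩
        · exact Or.inr h
      rcases hKZ v hv with h | h
      · have h3 := (mem_filter.1 h).2
        have h4 : #{u ∈ A0 | ¬ G.Adj v u} ≤ #{u ∈ A | ¬ G.Adj v u} :=
          Finset.card_le_card (Finset.filter_subset_filter _ hA0A)
        omega
      · have h3 := hv'.2 h
        have h4 : #{u ∈ A0 | ¬ G.Adj v u} ≤ #{u ∈ A0 | Gᶜ.Adj v u} := by
          apply Finset.card_le_card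
          intro u hu
          simp only [mem_filter, SimpleGraph.compl_adj] at hu ⊢
          refine ⟨hu.1, ?_, hu.2⟩
          rintro rfl
          simp [hZ, hu.1] at h
        omega)
    refine le_trans ?_ this
    apply pow_le_pow_left₀ (by positivity)
    have : (0:ℝ) ≤ k := by positivity
    linarith
  · right
    obtain ⟨B1, hB1, hB1c⟩ := Finset.exists_subset_card_eq (show k / 2 ≤ #Y by omega)
    have hEZ : B1 \ B0 ⊆ {z ∈ Z | k ≤ 20 * #{a ∈ A0 | Gᶜ.Adj z a}} := by
      intro b hb
      rw [mem_sdiff] at hb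
      have := hB1 hb.1
      rw [hY, mem_union] at this
      exact this.resolve_left hb.2
    have hEc : #(B1 \ B0) ≤ #Z := Finset.card_le_card (hEZ.trans (filter_subset _ _))
    have hYA : ∀ b ∈ Y, b ∉ A0 := by
      intro b hb hbA
      rw [hY, mem_union] at hb
      rcases hb with h | h
      · exact Finset.disjoint_left.1 hd0 hbA h
      · simp [hZ, hbA] at h
    apply alt_paths Gᶜ A0 B1 (B1 \ B0) k _ sdiff_subset _ hB1c rfl (by omega) (by omega) hk
    · intro b hb hbE
      have hb0 : b ∈ B0 := by
        by_contra h
        exact hbE (mem_sdiff.2 ⟨hb, h⟩)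
      have h3 := (mem_filter.1 hb0).2
      have h4 : #{a ∈ A0 | ¬ Gᶜ.Adj b a} ≤ #{y ∈ A | G.Adj b y} := by
        apply Finset.card_le_card
        intro u hu
        simp only [mem_filter, SimpleGraph.compl_adj, not_and, not_not] at hu ⊢
        refine ⟨hA0A hu.1, hu.2 ?_⟩
        rintro rfl
        exact hYA _ (hB1 hb) hu.1
      have h5 : 1000 * #{a ∈ A0 | ¬ Gᶜ.Adj b a} ≤ k := by omega
      convert h5
    · intro b hb
      have h6 := (mem_filter.1 (hEZ hb)).2
      convert h6
    · rw [Finset.disjoint_left]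
      intro a ha hb
      exact hYA a (hB1 hb) ha

open Classical in
/-- number of adjacent ordered pairs -/
noncomputable def eC {V : Type*} (G : SimpleGraph V) (S T : Finset V) : ℝ :=
  ∑ x ∈ S, (#{y ∈ T | G.Adj x y} : ℝ)

/-- regular pair -/
def UNI {V : Type*} (G : SimpleGraph V) (ε : ℝ) (S T : Finset V) : Prop :=
  ∃ δ : ℝ, ∀ S' ⊆ S, ∀ T' ⊆ T, ε * (#S : ℝ) ≤ #S' → ε * (#T : ℝ) ≤ #T' →
    |eC G S' T' - δ * (#S' * #T')| ≤ ε * (#S' * #T')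

lemma eC_comm {V : Type*} (G : SimpleGraph V) (S T : Finset V) : eC G S T = eC G T S := by
  classical
  unfold eC
  simp only [Finset.card_filter, Nat.cast_sum]
  rw [Finset.sum_comm]
  simp only [G.adj_comm]

lemma eC_compl {V : Type*} (G : SimpleGraph V) (S T : Finset V) (h : Disjoint S T) :
    eC Gᶜ S T = #S * #T - eC G S T := by
  classical
  unfold eC
  rw [eq_sub_iff_add_eq, ← Finset.sum_add_distrib]
  have : ∀ x ∈ S, ((#{y ∈ T | Gᶜ.Adj x y} : ℝ) + (#{y ∈ T | G.Adj x y} : ℝ)) = #T := by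
    intro x hx
    have h1 := Finset.card_filter_add_card_filter_not (s := T) (fun y => G.Adj x y)
    have h2 : #{y ∈ T | ¬ G.Adj x y} = #{y ∈ T | Gᶜ.Adj x y} := by
      congr 1
      apply Finset.filter_congr
      intro y hy
      simp only [SimpleGraph.compl_adj]
      have : x ≠ y := by rintro rfl; exact Finset.disjoint_left.1 h hx hy
      tauto
    rw [← h1, h2]; push_cast; ring
  convert Finset.sum_congr rfl this using 1
  · refine Finset.sum_congr rfl fun x _ => ?_
    congr
  · simp

lemma UNI.symm {V : Type*} {G : SimpleGraph V} {ε : ℝ} {S T : Finset V} (h : UNI G ε S T) :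
    UNI G ε T S := by
  obtain ⟨δ, h⟩ := h
  refine ⟨δ, fun S' hS' T' hT' h1 h2 => ?_⟩
  have := h T' hT' S' hS' h2 h1
  rwa [eC_comm, mul_comm (#T' : ℝ)] at this

lemma UNI.compl {V : Type*} {G : SimpleGraph V} {ε : ℝ} {S T : Finset V} (h : UNI G ε S T)
    (hd : Disjoint S T) : UNI Gᶜ ε S T := by
  obtain ⟨δ, h⟩ := h
  refine ⟨1 - δ, fun S' hS' T' hT' h1 h2 => ?_⟩
  have := h S' hS' T' hT' h1 h2
  rw [eC_compl _ _ _ (Finset.disjoint_of_subset_left hS' (Finset.disjoint_of_subset_right hT' hd))]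
  rw [abs_le] at this ⊢
  constructor <;> linarith

lemma UNI.dich {V : Type*} {G : SimpleGraph V} {ε : ℝ} {S T : Finset V} (h : UNI G ε S T)
    (d : ℝ) (hε : ε ≤ 1) :
    (DensePair G ε d S T ∧ DensePair G ε d T S) ∨ eC G S T ≤ (d + 2 * ε) * (#S * #T) := by
  obtain ⟨δ, h⟩ := h
  have hST : (0:ℝ) ≤ #S * #T := by positivity
  by_cases hδ : d + ε ≤ δ
  · left
    have key : ∀ S' ⊆ S, ∀ T' ⊆ T, ε * (#S : ℝ) ≤ #S' → ε * (#T : ℝ) ≤ #T' →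
        d * #S' * #T' ≤ eC G S' T' := by
      intro S' hS' T' hT' h1 h2
      have := h S' hS' T' hT' h1 h2
      rw [abs_le] at this
      have h0 : (0:ℝ) ≤ #S' * #T' := by positivity
      nlinarith
    refine ⟨fun S' hS' T' hT' h1 h2 => key S' hS' T' hT' h1 h2, fun S' hS' T' hT' h1 h2 => ?_⟩
    have := key T' hT' S' hS' h2 h1
    rw [eC_comm] at this
    unfold eC at this
    linarith
  · right
    have := h S subset_rfl T subset_rfl (by nlinarith [(Nat.cast_nonneg #S : (0:ℝ) ≤ _)])
      (by nlinarith [(Nat.cast_nonneg #T : (0:ℝ) ≤ _)])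
    rw [abs_le] at this
    nlinarith

/-- reduced graph -/
def RG {V ι : Type*} (G : SimpleGraph V) (ε d : ℝ) (Vc : ι → Finset V) : SimpleGraph ι where
  Adj i j := i ≠ j ∧ DensePair G ε d (Vc i) (Vc j) ∧ DensePair G ε d (Vc j) (Vc i)
  symm := ⟨fun _ _ h => ⟨h.1.symm, h.2.2, h.2.1⟩⟩
  loopless := ⟨fun _ h => h.1 rfl⟩

open Classical in
/-- exceptional pairs -/
noncomputable def XP {V ι : Type*} [Fintype ι] (G : SimpleGraph V) (ε : ℝ) (Vc : ι → Finset V) :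
    Finset (ι × ι) :=
  univ.filter (fun p => p.1 = p.2 ∨ ¬ UNI G ε (Vc p.1) (Vc p.2))

lemma XP_compl {V ι : Type*} [Fintype ι] (G : SimpleGraph V) (ε : ℝ) (Vc : ι → Finset V)
    (hdisj : ∀ i j, i ≠ j → Disjoint (Vc i) (Vc j)) : XP Gᶜ ε Vc ⊆ XP G ε Vc := by
  intro p hp
  simp only [XP, mem_filter, mem_univ, true_and] at hp ⊢
  rcases hp with h | h
  · exact Or.inl h
  · by_cases h' : p.1 = p.2
    · exact Or.inl h'
    · exact Or.inr fun hu => h (hu.compl (hdisj _ _ h'))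

lemma bad_sub {V ι : Type*} [Fintype ι] (G : SimpleGraph V) (ε d : ℝ) (Vc : ι → Finset V)
    (hdisj : ∀ i j, i ≠ j → Disjoint (Vc i) (Vc j)) (hne : ∀ i, (Vc i).Nonempty) (hε : ε ≤ 1)
    (hd : 2 * (d + 2 * ε) < 1) : badP (RG G ε d Vc) (RG Gᶜ ε d Vc) ⊆ XP G ε Vc := by
  intro p hp
  simp only [XP, badP, mem_filter, mem_univ, true_and] at hp ⊢
  by_contra hcon
  push Not at hcon
  obtain ⟨h1, h2⟩ := hcon
  rcases h2.dich d hε with h | h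
  · exact hp.1 ⟨h1, h⟩
  rcases (h2.compl (hdisj _ _ h1)).dich d hε with h' | h'
  · exact hp.2 ⟨h1, h'⟩
  rw [eC_compl _ _ _ (hdisj _ _ h1)] at h'
  have a1 : (0:ℝ) < #(Vc p.1) := by exact_mod_cast (hne _).card_pos
  have a2 : (0:ℝ) < #(Vc p.2) := by exact_mod_cast (hne _).card_pos
  have := mul_pos a1 a2
  nlinarith

open Classical in
lemma sparse_bound {V ι : Type*} [Fintype ι] (Vc : ι → Finset V)
    (hdisj : ∀ i j, i ≠ j → Disjoint (Vc i) (Vc j)) (M : ℝ) (hM : ∀ i, (#(Vc i) : ℝ) ≤ M)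
    (p : V → V → Prop) (A B : Finset ι) (X : Finset (ι × ι)) (r : ℝ) (hr : 0 ≤ r)
    (h : ∀ i ∈ B, ∀ j ∈ A, (i, j) ∉ X → ∑ x ∈ Vc i, (#{y ∈ Vc j | p x y} : ℝ) ≤ r * M ^ 2) :
    ∑ x ∈ B.biUnion Vc, (#{y ∈ A.biUnion Vc | p x y} : ℝ) ≤
      (#X + r * (Fintype.card ι : ℝ) ^ 2) * M ^ 2 := by
  have e1 : ∑ x ∈ B.biUnion Vc, (#{y ∈ A.biUnion Vc | p x y} : ℝ) =
      ∑ i ∈ B, ∑ j ∈ A, ∑ x ∈ Vc i, (#{y ∈ Vc j | p x y} : ℝ) := by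
    rw [Finset.sum_biUnion (fun i _ j _ hij => hdisj i j hij)]
    refine Finset.sum_congr rfl fun i _ => ?_
    rw [Finset.sum_comm]
    refine Finset.sum_congr rfl fun x _ => ?_
    rw [Finset.filter_biUnion, Finset.card_biUnion]
    · push_cast; rfl
    · intro i _ j _ hij
      exact Finset.disjoint_filter_filter (hdisj i j hij)
  rw [e1, ← Finset.sum_product']
  have hstep : ∀ q ∈ B ×ˢ A, ∑ x ∈ Vc q.1, (#{y ∈ Vc q.2 | p x y} : ℝ) ≤
      (if q ∈ X then 1 else 0) * M ^ 2 + r * M ^ 2 := by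
    intro q hq
    rw [mem_product] at hq
    by_cases hX : q ∈ X
    · rw [if_pos hX]
      have hM0 : 0 ≤ M := (Nat.cast_nonneg _).trans (hM q.1)
      have : ∑ x ∈ Vc q.1, (#{y ∈ Vc q.2 | p x y} : ℝ) ≤ ∑ x ∈ Vc q.1, M := by
        refine Finset.sum_le_sum fun x _ => le_trans ?_ (hM q.2)
        exact_mod_cast Finset.card_filter_le _ _
      rw [Finset.sum_const, nsmul_eq_mul] at this
      have := hM q.1
      have : 0 ≤ r * M^2 := by positivity
      nlinarith
    · rw [if_neg hX]
      have := h q.1 hq.1 q.2 hq.2 hX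
      linarith
  refine (Finset.sum_le_sum hstep).trans ?_
  rw [Finset.sum_add_distrib, ← Finset.sum_mul, Finset.sum_const, nsmul_eq_mul, add_mul]
  have hM2 : 0 ≤ M ^ 2 := sq_nonneg _
  apply add_le_add
  · apply mul_le_mul_of_nonneg_right _ hM2
    rw [Finset.sum_ite_mem]
    simp only [sum_const, nsmul_eq_mul, mul_one]
    exact_mod_cast Finset.card_le_card Finset.inter_subset_right
  · have : ((#(B ×ˢ A) : ℕ) : ℝ) ≤ (Fintype.card ι : ℝ) ^ 2 := by
      rw [card_product, sq]; push_cast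
      have hA : (#A : ℝ) ≤ Fintype.card ι := by exact_mod_cast Finset.card_le_univ A
      have hB : (#B : ℝ) ≤ Fintype.card ι := by exact_mod_cast Finset.card_le_univ B
      gcongr
    have h0 : 0 ≤ r * M ^ 2 := by positivity
    nlinarith

lemma longM_paths {V ι : Type*} [Fintype V] [Fintype ι] (G : SimpleGraph V) (Vc : ι → Finset V)
    (hdisj : ∀ i j, i ≠ j → Disjoint (Vc i) (Vc j)) (m : ℕ) 
    (hVc : ∀ i, m ≤ #(Vc i) ∧ #(Vc i) ≤ m + 1) (k : ℕ) (hk : 2 ≤ k)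
    (ht : 0 < Fintype.card ι) (hn : k - 1 + k / 2 ≤ Fintype.card ι * (m + 1))
    (ε d κ : ℝ) (hκ : 0 < κ) (hκ1 : κ ≤ 1 / 3) (hm : (Fintype.card ι : ℝ) + 5 ≤ κ / 2 * m)
    (hε : 0 < ε) (hd : 0 < d) (hd1 : d ≤ 1) (hεd : ε ≤ d * (κ / 2) / 4)
    (hL : LongM (RG G ε d Vc) ((2 / 3 + κ) * (Fintype.card ι : ℝ))) :
    ((d * (κ / 2) / 2) * m) ^ k ≤ ((PL G k).ncard : ℝ) := by
  classical
  obtain ⟨T, σ, hT, hσ, hadj, hreach⟩ := hL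
  set t := Fintype.card ι with htdef
  have ht' : (1:ℝ) ≤ t := by exact_mod_cast ht
  have hm0 : (0:ℝ) < m := by
    by_contra hcon
    have : (m:ℝ) ≤ 0 := not_lt.1 hcon
    nlinarith
  have hm1 : 0 < m := by exact_mod_cast hm0
  have hTt : (#T : ℝ) ≤ t := by exact_mod_cast Finset.card_le_univ T
  have hT0 : (0:ℝ) < #T := lt_of_lt_of_le (by positivity) hT
  have hT1 : 0 < #T := by exact_mod_cast hT0
  have hkq : k ≤ 2 * (k / (2 * #T) + 1) * #T := by
    have := Nat.lt_div_mul_add (a := k) (b := 2 * #T) (by omega)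
    nlinarith
  obtain ⟨w, hw, hc⟩ := walk_of_matching (RG G ε d Vc) T σ (Finset.card_pos.1 hT1) hσ hadj hreach
    (k / (2 * #T) + 1) (Nat.le_add_left 1 _) k hkq
  have hkr : (3:ℝ) * k ≤ 2 * t * (m + 1) + 3 := by
    have : 3 * k ≤ 2 * (t * (m + 1)) + 3 := by clear hkq hc; omega
    have : ((3 * k : ℕ) : ℝ) ≤ ((2 * (t * (m + 1)) + 3 : ℕ) : ℝ) := by exact_mod_cast this
    push_cast at this; linarith
  refine walk_paths G Vc hdisj m hm1 (fun i => ⟨(hVc i).1, by have := (hVc i).2; omega⟩) k w ε d (κ / 2)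
    (fun a ha => ⟨(hw a ha).1, (hw a ha).2.1⟩) ?_ hε hd hd1 (by positivity) (by linarith) hεd
  intro i
  have h1 : (#{a ∈ range k | w a = i} : ℝ) ≤ 2 * ((k / (2 * #T) : ℕ) + 1) + #T := by
    exact_mod_cast hc i
  refine h1.trans ?_
  have h2 : ((k / (2 * #T) : ℕ) : ℝ) ≤ k / (2 * #T) := by
    have := @Nat.cast_div_le ℝ _ _ _ k (2 * #T)
    push_cast at this; exact this
  have h3 : (k:ℝ) / (2 * #T) ≤ ((1 - κ) * m + 3) / 2 := by
    rw [div_le_iff₀ (by positivity)]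
    have : ((2 / 3 + κ) * t) * ((1 - κ) * m + 3) ≤ #T * ((1 - κ) * m + 3) := by
      apply mul_le_mul_of_nonneg_right hT
      have : 0 ≤ (1 - κ) * m := mul_nonneg (by linarith) hm0.le
      linarith
    have h5 : (2/3:ℝ) ≤ (2 / 3 + κ) * (1 - κ) := by nlinarith
    have h6 : (2/3:ℝ) * (t * m) ≤ (2 / 3 + κ) * (1 - κ) * (t * m) :=
      mul_le_mul_of_nonneg_right h5 (by positivity)
    have h7 : 0 ≤ κ * t := by positivity
    nlinarith
  nlinarith

lemma ext_paths {V ι : Type*} [Fintype V] [Fintype ι] (G : SimpleGraph V) (Vc : ι → Finset V)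
    (hdisj : ∀ i j, i ≠ j → Disjoint (Vc i) (Vc j)) (m : ℕ) 
    (hVc : ∀ i, m ≤ #(Vc i) ∧ #(Vc i) ≤ m + 1) (k : ℕ) (hk : 8 ≤ k)
    (hV : Fintype.card V = k - 1 + k / 2)
    (hn : k - 1 + k / 2 ≤ Fintype.card ι * (m + 1)) (hn2 : Fintype.card ι * m ≤ k - 1 + k / 2)
    (htk : 10000 * (Fintype.card ι + 2) ≤ k)
    (ε d : ℝ) (hε : 0 < ε) (hε1 : ε ≤ 1 / 10 ^ 9) (hd : 0 < d) (hd1 : d ≤ 1 / 10 ^ 7)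
    (hX : (#(XP G ε Vc) : ℝ) ≤ (1 / 100000) ^ 2 * (Fintype.card ι : ℝ) ^ 2)
    (hE : ExtS (RG G ε d Vc) (RG Gᶜ ε d Vc) ((2/3 - 11 * (1 / 100000)) * (Fintype.card ι : ℝ))
      ((1/3 - 4 * (1 / 100000)) * (Fintype.card ι : ℝ))) :
    ((k : ℝ) / 40) ^ k ≤ ((PL G k).ncard : ℝ) ∨ ((k : ℝ) / 40) ^ k ≤ ((PL Gᶜ k).ncard : ℝ) := by
  classical
  obtain ⟨A, B, hAB, hA, hB, hAA, hABn⟩ := hE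
  set t := Fintype.card ι with htdef
  have htm1 : (t:ℝ) * m ≤ 3/2 * k := by
    have h1 : 2 * (t * m) ≤ 3 * k := by omega
    have h2 : ((2 * (t * m) : ℕ) : ℝ) ≤ ((3 * k : ℕ) : ℝ) := by exact_mod_cast h1
    push_cast at h2; linarith
  have htm2 : (3/2:ℝ) * k - 3/2 ≤ t * (m + 1) := by
    have h1 : 3 * k ≤ 2 * (t * (m + 1)) + 3 := by omega
    have h2 : ((3 * k : ℕ) : ℝ) ≤ ((2 * (t * (m + 1)) + 3 : ℕ) : ℝ) := by exact_mod_cast h1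
    push_cast at h2; linarith
  have htk' : (10000:ℝ) * (t + 2) ≤ k := by exact_mod_cast htk
  have hcard : ∀ S : Finset ι, (#S : ℝ) * m ≤ #(S.biUnion Vc) := by
    intro S
    rw [Finset.card_biUnion (fun i _ j _ hij => hdisj i j hij)]
    have := Finset.card_nsmul_le_sum S (fun i => #(Vc i)) m (fun i _ => (hVc i).1)
    rw [smul_eq_mul] at this
    exact_mod_cast this
  have hM : ∀ i, (#(Vc i) : ℝ) ≤ (m:ℝ) + 1 := fun i => by exact_mod_cast (hVc i).2
  have ht0 : (0:ℝ) ≤ t := by positivity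
  have hm0 : (0:ℝ) ≤ m := by positivity
  have hk0 : (0:ℝ) ≤ k := by positivity
  have htot : (t:ℝ)^2 * ((m:ℝ) + 1)^2 ≤ (1.6 * k)^2 := by
    rw [← mul_pow]
    apply pow_le_pow_left₀ (by positivity)
    nlinarith
  have hfin : ∀ X : Finset (ι × ι), (#X : ℝ) ≤ (1 / 100000) ^ 2 * (t : ℝ) ^ 2 →
      1000000 * ((#X + (d + 2 * ε) * (t:ℝ)^2) * ((m:ℝ)+1)^2) ≤ k * k := by
    intro X hX
    have h1 : (#X : ℝ) + (d + 2 * ε) * (t:ℝ)^2 ≤ (2 / 10^7) * (t:ℝ)^2 := by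
      have : d + 2 * ε ≤ 1.1 / 10^7 := by norm_num at hε1 hd1 ⊢; linarith
      have h0 : (0:ℝ) ≤ (t:ℝ)^2 := sq_nonneg _
      have := mul_le_mul_of_nonneg_right this h0
      norm_num at hX this ⊢
      linarith
    have h2 := mul_le_mul_of_nonneg_right h1 (sq_nonneg ((m:ℝ)+1))
    nlinarith
  have hsm : ∀ (H : SimpleGraph V), ∀ i j, i ≠ j → UNI H ε (Vc i) (Vc j) → ¬ (RG H ε d Vc).Adj i j →
      eC H (Vc i) (Vc j) ≤ (d + 2 * ε) * ((m:ℝ) + 1)^2 := by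
    intro H i j hij hu hna
    rcases hu.dich d (by norm_num at hε1; linarith) with h | h
    · exact absurd ⟨hij, h⟩ hna
    · refine h.trans ?_
      rw [sq]
      have := hM i
      have := hM j
      gcongr
  have hAB' : Disjoint (A.biUnion Vc) (B.biUnion Vc) := by
    rw [Finset.disjoint_biUnion_left]
    intro i hi
    rw [Finset.disjoint_biUnion_right]
    intro j hj
    apply hdisj
    rintro rfl
    exact Finset.disjoint_left.1 hAB hi hj
  have main := extremal Gᶜ k hk hV (A.biUnion Vc) (B.biUnion Vc) hAB' ?_ ?_ ?_ ?_
  · rw [compl_compl] at main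
    exact main.symm
  · have h1 := hcard A
    have h2 := mul_le_mul_of_nonneg_right hA hm0
    have : (999:ℝ) * k ≤ 1000 * #(A.biUnion Vc) := by nlinarith
    exact_mod_cast this
  · have h1 := hcard B
    have h2 := mul_le_mul_of_nonneg_right hB hm0
    have : (499:ℝ) * k ≤ 1000 * #(B.biUnion Vc) := by nlinarith
    exact_mod_cast this
  · have h1 := sparse_bound Vc hdisj ((m:ℝ)+1) hM (fun x y => ¬ Gᶜ.Adj x y) A A (XP G ε Vc) (d + 2 * ε)
      (by positivity) (by
        intro i hi j hj hij
        simp only [XP, mem_filter, mem_univ, true_and, not_or, not_not] at hij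
        refine le_trans (le_of_eq ?_) (hsm G i j hij.1 hij.2 (hAA i hi j hj))
        unfold eC
        refine Finset.sum_congr rfl fun x hx => ?_
        congr 2
        ext y
        simp only [mem_filter]
        refine and_congr_right fun hy => ?_
        have : x ≠ y := by rintro rfl; exact Finset.disjoint_left.1 (hdisj i j hij.1) hx hy
        simp only [SimpleGraph.compl_adj]
        tauto)
    have h2 := hfin _ hX
    have h3 := (mul_le_mul_of_nonneg_left h1 (by norm_num : (0:ℝ) ≤ 1000000)).trans h2
    rw [← Nat.cast_sum] at h3
    norm_cast at h3
    convert h3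
  · have h1 := sparse_bound Vc hdisj ((m:ℝ)+1) hM (fun x y => Gᶜ.Adj x y) A B (XP Gᶜ ε Vc) (d + 2 * ε)
      (by positivity) (by
        intro i hi j hj hij
        simp only [XP, mem_filter, mem_univ, true_and, not_or, not_not] at hij
        refine le_trans (le_of_eq ?_) (hsm Gᶜ i j hij.1 hij.2 (fun h => hABn j hj i hi h.symm))
        unfold eC
        refine Finset.sum_congr rfl fun x hx => ?_
        congr)
    have h2 := hfin _ (le_trans (by exact_mod_cast Finset.card_le_card (XP_compl G ε Vc hdisj)) hX)
    have h3 := (mul_le_mul_of_nonneg_left h1 (by norm_num : (0:ℝ) ≤ 1000000)).trans h2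
    rw [← Nat.cast_sum] at h3
    norm_cast at h3

lemma uni_of_isUniform {V : Type*} (G : SimpleGraph V) [DecidableRel G.Adj] (ε : ℝ) 
    (S T : Finset V) (h : G.IsUniform ε S T) : UNI G ε S T := by
  classical
  refine ⟨(G.edgeDensity S T : ℝ), fun S' hS' T' hT' h1 h2 => ?_⟩
  have := h hS' hT' (by linarith) (by linarith)
  have e : eC G S' T' = (#(G.interedges S' T') : ℝ) := by
    unfold eC SimpleGraph.interedges Rel.interedges
    rw [Finset.card_filter, Finset.sum_product]
    push_cast
    refine Finset.sum_congr rfl fun x _ => ?_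
    rw [Finset.card_filter]
    push_cast
    refine Finset.sum_congr rfl fun y _ => ?_
    congr
  by_cases h0 : (#S' : ℝ) * #T' = 0
  · have : (#(G.interedges S' T') : ℝ) ≤ #S' * #T' := by
      exact_mod_cast Rel.card_interedges_le_mul G.Adj S' T'
    have h3 : (0:ℝ) ≤ #(G.interedges S' T') := by positivity
    rw [e, h0]
    have : (#(G.interedges S' T') : ℝ) = 0 := by linarith
    rw [this]; simp
  · have hpos : (0:ℝ) < #S' * #T' := lt_of_le_of_ne (by positivity) (Ne.symm h0)
    have e2 : (#(G.interedges S' T') : ℝ) = G.edgeDensity S' T' * (#S' * #T') := by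
      rw [SimpleGraph.edgeDensity_def]
      push_cast
      rw [div_mul_cancel₀ _ h0]
    rw [e, e2, ← sub_mul, abs_mul, abs_of_pos hpos]
    exact mul_le_mul_of_nonneg_right this.le hpos.le

lemma large : ∃ c : ℝ, 0 < c ∧ ∃ K0 : ℕ, ∀ k : ℕ, K0 ≤ k → ∀ R : SimpleGraph (Fin (k - 1 + k / 2)),
    (c * k) ^ k ≤ ((PL R k).ncard : ℝ) ∨ (c * k) ^ k ≤ ((PL Rᶜ k).ncard : ℝ) := by
  classical
  obtain ⟨ε, hεdef⟩ : ∃ ε : ℝ, ε = 1 / 10 ^ 14 := ⟨_, rfl⟩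
  obtain ⟨d, hddef⟩ : ∃ d : ℝ, d = 1 / 10 ^ 7 := ⟨_, rfl⟩
  obtain ⟨l, hl⟩ : ∃ l : ℕ, l = 10 ^ 11 := ⟨_, rfl⟩
  obtain ⟨M0, hM0⟩ : ∃ M0 : ℕ, M0 = SzemerediRegularity.bound ε l := ⟨_, rfl⟩
  have hε : 0 < ε := by rw [hεdef]; norm_num
  have hd : 0 < d := by rw [hddef]; norm_num
  have hM0pos : (0:ℝ) < (M0:ℝ) + 1 := by positivity
  refine ⟨(d * ((1 / 100000) / 2) / 2) / (2 * (M0 + 1)), by positivity,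
    l + 1000000 * (M0 + 5) * (M0 + 1) + 8, fun k hk => ?_⟩
  generalize hn : k - 1 + k / 2 = n
  intro R
  have hkn : k ≤ n := by omega
  obtain ⟨P, hP, hPl, hPb, hPu⟩ := szemeredi_regularity R (l := l) hε (by
    rw [Fintype.card_fin]; nlinarith)
  rw [← hM0] at hPb
  set t := #P.parts with ht
  have hct : Fintype.card P.parts = t := by simp [ht]
  have ht0 : 0 < t := by have : 0 < l := by rw [hl]; norm_num
                         omega
  set m := n / t with hm
  have hmt : t * m ≤ n := Nat.mul_div_le n t
  have hmt1 : n < t * (m + 1) := by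
    have := Nat.lt_mul_div_succ n ht0
    exact this
  set Vc : P.parts → Finset (Fin n) := fun i => i.1 with hVcdef
  have hdisj : ∀ i j, i ≠ j → Disjoint (Vc i) (Vc j) := by
    intro i j hij
    exact P.disjoint i.2 j.2 (fun h => hij (Subtype.ext h))
  have hVc : ∀ i, m ≤ #(Vc i) ∧ #(Vc i) ≤ m + 1 := by
    intro i
    have h1 := hP.average_le_card_part i.2
    have h2 := hP.card_part_le_average_add_one i.2
    rw [Finset.card_univ, Fintype.card_fin] at h1 h2
    exact ⟨h1, h2⟩
  have htM : t ≤ M0 := hPb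
  have hmbig : 400000 * (t + 5) ≤ m := by
    by_contra hcon
    push Not at hcon
    have h1 : m + 1 ≤ 400000 * (M0 + 5) := by omega
    have h2 : t * (m + 1) ≤ (M0 + 1) * (400000 * (M0 + 5)) := Nat.mul_le_mul (by omega) h1
    nlinarith
  have hmR : (t:ℝ) + 5 ≤ (1 / 100000) / 2 * m := by
    have : (400000:ℝ) * (t + 5) ≤ m := by exact_mod_cast hmbig
    have h0 : (0:ℝ) ≤ t := by positivity
    linarith
  have htk : 10000 * (t + 2) ≤ k := by
    have h1 : 1000000 * (M0 + 5) * 1 ≤ 1000000 * (M0 + 5) * (M0 + 1) :=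
      Nat.mul_le_mul_left _ (Nat.le_add_left 1 M0)
    linarith only [h1, hk, htM, Nat.zero_le l]
  have htl : (10:ℝ)^11 ≤ t := by
    have hlR : (l:ℝ) = 10 ^ 11 := by rw [hl]; norm_num
    rw [← hlR]
    exact Nat.cast_le.2 hPl
  have hX : (#(XP R ε Vc) : ℝ) ≤ (1 / 100000) ^ 2 * (t : ℝ) ^ 2 := by
    have h1 : #(XP R ε Vc) ≤ t + #(P.nonUniforms R ε) := by
      have hsub : XP R ε Vc ⊆ (univ.image fun i : P.parts => (i, i)) ∪
          (univ.filter fun p : P.parts × P.parts => (p.1.1, p.2.1) ∈ P.nonUniforms R ε) := by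
        intro p hp
        simp only [XP, mem_filter, mem_univ, true_and] at hp
        rw [mem_union]
        by_cases h : p.1 = p.2
        · left
          rw [mem_image]
          exact ⟨p.1, mem_univ _, Prod.ext rfl h⟩
        · right
          rw [mem_filter]
          refine ⟨mem_univ _, ?_⟩
          rw [Finpartition.mk_mem_nonUniforms]
          refine ⟨p.1.2, p.2.2, fun h' => h (Subtype.ext h'), fun hu => ?_⟩
          exact (hp.resolve_left h) (uni_of_isUniform R ε _ _ hu)
      refine (Finset.card_le_card hsub).trans ((Finset.card_union_le _ _).trans ?_)
      apply Nat.add_le_add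
      · exact Finset.card_image_le.trans (by rw [Finset.card_univ, hct])
      · apply Finset.card_le_card_of_injOn (fun p => (p.1.1, p.2.1))
        · intro p hp
          exact (mem_filter.1 hp).2
        · intro p _ q _ hpq
          simp only [Prod.mk.injEq] at hpq
          exact Prod.ext (Subtype.ext hpq.1) (Subtype.ext hpq.2)
    have h2 : (#(P.nonUniforms R ε) : ℝ) ≤ (t * (t - 1) : ℕ) * ε := hPu
    have h3 : ((t * (t - 1) : ℕ) : ℝ) ≤ (t:ℝ) ^ 2 := by
      rw [sq]; exact_mod_cast Nat.mul_le_mul_left t (Nat.sub_le t 1)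
    have h4 : (#(XP R ε Vc) : ℝ) ≤ t + #(P.nonUniforms R ε) := by exact_mod_cast h1
    have h5 : ((t * (t - 1) : ℕ) : ℝ) * ε ≤ (t:ℝ)^2 * ε := mul_le_mul_of_nonneg_right h3 hε.le
    have h6 : (10:ℝ)^11 * t ≤ (t:ℝ)^2 := by
      rw [sq]; exact mul_le_mul_of_nonneg_right htl (by positivity)
    have h7 : (0:ℝ) ≤ (t:ℝ)^2 := by positivity
    rw [hεdef] at h5
    rw [hεdef] at h2 h4 ⊢
    norm_num at h6 h5 h2 ⊢
    linarith
  have hX' : (#(XP Rᶜ ε Vc) : ℝ) ≤ (1 / 100000) ^ 2 * (t : ℝ) ^ 2 :=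
    le_trans (by exact_mod_cast Finset.card_le_card (XP_compl R ε Vc hdisj)) hX
  have hne : ∀ i, (Vc i).Nonempty := fun i => P.nonempty_of_mem_parts i.2
  have hbad : (#(badP (RG R ε d Vc) (RG Rᶜ ε d Vc)) : ℝ) ≤
      (1 / 100000) ^ 2 * (Fintype.card P.parts : ℝ) ^ 2 := by
    rw [hct]
    refine le_trans ?_ hX
    exact_mod_cast Finset.card_le_card (bad_sub R ε d Vc hdisj hne (by rw [hεdef]; norm_num)
      (by rw [hεdef, hddef]; norm_num))
  have hstab := stability (RG R ε d Vc) (RG Rᶜ ε d Vc) (1 / 100000) (by rw [hct]; exact ht0)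
    (by norm_num) (by norm_num) hbad
  have hM1 : (1:ℝ) ≤ (M0:ℝ) + 1 := by
    have : (0:ℝ) ≤ M0 := by positivity
    linarith
  have hk0 : (0:ℝ) ≤ k := by positivity
  have hc1 : (d * ((1 / 100000) / 2) / 2) / (2 * (M0 + 1)) * k ≤ (d * ((1 / 100000) / 2) / 2) * m := by
    have : (k:ℝ) ≤ 2 * (M0 + 1) * m := by
      have h1 : k ≤ 2 * (M0 + 1) * m := by
        have : t * (m + 1) ≤ M0 * (m + m) := Nat.mul_le_mul htM (by omega)
        nlinarith
      exact_mod_cast h1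
    rw [div_mul_eq_mul_div, mul_div_assoc]
    apply mul_le_mul_of_nonneg_left _ (by positivity)
    rw [div_le_iff₀ (by positivity)]
    linarith
  have hc2 : (d * ((1 / 100000) / 2) / 2) / (2 * (M0 + 1)) * k ≤ (k:ℝ) / 40 := by
    have : (d * ((1 / 100000) / 2) / 2) / (2 * ((M0:ℝ) + 1)) ≤ 1 / 40 := by
      rw [div_le_iff₀ (by positivity), hddef]
      norm_num
      linarith
    have := mul_le_mul_of_nonneg_right this hk0
    linarith
  have hc0 : 0 ≤ (d * ((1 / 100000) / 2) / 2) / (2 * ((M0:ℝ) + 1)) * k := by positivity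
  have p1 := pow_le_pow_left₀ hc0 hc1 k
  have p2 := pow_le_pow_left₀ hc0 hc2 k
  have hd1 : d ≤ 1 := by rw [hddef]; norm_num
  have hεd : ε ≤ d * ((1 / 100000) / 2) / 4 := by rw [hεdef, hddef]; norm_num
  rcases hstab with h | h | h | h
  · left
    exact p1.trans (longM_paths R Vc hdisj m hVc k (by omega) (by rw [hct]; exact ht0)
      (by rw [hct, hn]; exact hmt1.le) ε d (1 / 100000) (by norm_num) (by norm_num) (by rw [hct]; exact hmR)
      hε hd hd1 hεd h)
  · right
    exact p1.trans (longM_paths Rᶜ Vc hdisj m hVc k (by omega) (by rw [hct]; exact ht0)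
      (by rw [hct, hn]; exact hmt1.le) ε d (1 / 100000) (by norm_num) (by norm_num) (by rw [hct]; exact hmR)
      hε hd hd1 hεd h)
  · rcases ext_paths R Vc hdisj m hVc k (by omega) (by rw [Fintype.card_fin, hn]) (by rw [hct, hn]; exact hmt1.le)
      (by rw [hct, hn]; exact hmt) (by rw [hct]; exact htk) ε d hε (by rw [hεdef]; norm_num) hd hddef.le
      (by rw [hct]; exact hX) h with h | h
    · exact Or.inl (p2.trans h)
    · exact Or.inr (p2.trans h)
  · have hcc : RG R ε d Vc = RG Rᶜᶜ ε d Vc := by rw [compl_compl]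
    rw [hcc] at h
    rcases ext_paths Rᶜ Vc hdisj m hVc k (by omega) (by rw [Fintype.card_fin, hn]) (by rw [hct, hn]; exact hmt1.le)
      (by rw [hct, hn]; exact hmt) (by rw [hct]; exact htk) ε d hε (by rw [hεdef]; norm_num) hd hddef.le
      (by rw [hct]; exact hX') h with h | h
    · exact Or.inr (p2.trans h)
    · rw [compl_compl] at h
      exact Or.inl (p2.trans h)

lemma pc_of_PL {V : Type*} [Fintype V] (G : SimpleGraph V) (k : ℕ) (hk : 2 ≤ k) (hne : (PL G k).Nonempty) :
    1 ≤ pathCount G k ∧ (PL G k).ncard ≤ 3 * pathCount G k := by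
  have h1 := PL_two_le (G := G) hk hne
  have h2 := PL_ncard_le G k
  unfold pathCount
  omega

/-- There is a constant `c > 0` such that for every `k ≥ 2`, every
two-coloring of `K_n` with `n = k - 1 + ⌊k/2⌋` contains at least `(ck)^k`
monochromatic copies of the path `P_k`. -/
theorem threshold_multiplicity_paths :
    ∃ c : ℝ, 0 < c ∧ ∀ k : ℕ, 2 ≤ k →
      ∀ R : SimpleGraph (Fin (k - 1 + k / 2)),
        (c * k) ^ k ≤ ((pathCount R k + pathCount Rᶜ k : ℕ) : ℝ) := by
  obtain ⟨c, hc, K0, hK⟩ := large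
  have hK1 : (0:ℝ) < (K0:ℝ) + 1 := by positivity
  refine ⟨min (c / 3) (1 / (K0 + 1)), lt_min (by positivity) (by positivity), fun k hk R => ?_⟩
  have hk0 : (0:ℝ) ≤ k := by positivity
  have hk1 : (1:ℝ) ≤ k := by exact_mod_cast (by omega : 1 ≤ k)
  have hmin0 : 0 < min (c / 3) (1 / ((K0:ℝ) + 1)) := lt_min (by positivity) (by positivity)
  by_cases hkK : K0 ≤ k
  · have key : ∀ G : SimpleGraph (Fin (k - 1 + k / 2)), (c * k) ^ k ≤ ((PL G k).ncard : ℝ) →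
        (min (c / 3) (1 / ((K0:ℝ) + 1)) * k) ^ k ≤ (pathCount G k : ℝ) := by
      intro G hG
      have hpos : (0:ℝ) < ((PL G k).ncard : ℝ) := lt_of_lt_of_le (by positivity) hG
      have hne : (PL G k).Nonempty := by
        rw [Set.nonempty_iff_ne_empty]
        intro h
        rw [h] at hpos
        simp at hpos
      have h1 : ((PL G k).ncard : ℝ) ≤ 3 * pathCount G k := by exact_mod_cast (pc_of_PL G k hk hne).2
      have h2 : (min (c / 3) (1 / ((K0:ℝ) + 1)) * k) ^ k ≤ (c * k / 3) ^ k := by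
        apply pow_le_pow_left₀ (by positivity)
        have := mul_le_mul_of_nonneg_right (min_le_left (c / 3) (1 / ((K0:ℝ) + 1))) hk0
        linarith
      have h3 : (c * k / 3) ^ k = (c * k) ^ k / 3 ^ k := div_pow _ _ _
      have h4 : (c * k) ^ k / 3 ^ k ≤ (c * k) ^ k / 3 := by
        apply div_le_div_of_nonneg_left (by positivity) (by norm_num)
        exact le_self_pow₀ (by norm_num) (by omega)
      linarith
    push_cast
    have q1 : (0:ℝ) ≤ pathCount R k := by positivity
    have q2 : (0:ℝ) ≤ pathCount Rᶜ k := by positivity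
    rcases hK k hkK R with h | h
    · linarith [key _ h]
    · linarith [key _ h]
  · have hone : 1 ≤ pathCount R k + pathCount Rᶜ k := by
      rcases GG R k hk (by rw [Fintype.card_fin]) with h | h
      · have := (pc_of_PL _ k hk h).1; omega
      · have := (pc_of_PL _ k hk h).1; omega
    have h1 : (min (c / 3) (1 / ((K0:ℝ) + 1)) * k) ^ k ≤ 1 := by
      apply pow_le_one₀ (by positivity)
      have := mul_le_mul_of_nonneg_right (min_le_right (c / 3) (1 / ((K0:ℝ) + 1))) hk0
      refine this.trans ?_
      rw [div_mul_eq_mul_div, div_le_one hK1, one_mul]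
      have : k ≤ K0 + 1 := by omega
      exact_mod_cast this
    exact h1.trans (by exact_mod_cast hone)
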